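/- If the rotation set of f ∈ Homeo₀(T²) is δ-upper-stable in Homeo₀(T²) for some δ > 0, then for any lift f̃ every extremal point of ρ(f̃) has rational coordinates, and when such a point is written in reduced form (p₁/q, p₂/q) with p₁, p₂, q integers, q ≥ 1 and gcd(p₁, p₂, q) = 1, one has q ≤ 4/(πδ²). In particular ρ(f̃) has only finitely many extremal points and is the convex hull of a finite subset of ℚ². -/

import Mathlib

noncomputable section

open Metric Set Filter Topology MeasureTheory Pointwise

/-- The plane `ℝ²` with the Euclidean metric. -/
abbrev R2 : Type := EuclideanSpace ℝ (Fin 2)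

/-- The integer lattice `ℤ² ⊂ ℝ²`. -/
def intLattice : AddSubgroup R2 where
  carrier := {v : R2 | ∀ i, ∃ n : ℤ, v i = (n : ℝ)}
  add_mem' := by
    intro a b ha hb i
    obtain ⟨m, hm⟩ := ha i
    obtain ⟨n, hn⟩ := hb i
    exact ⟨m + n, by push_cast; rw [← hm, ← hn]; rfl⟩
  zero_mem' := fun i => ⟨0, by simp⟩
  neg_mem' := by
    intro a ha i
    obtain ⟨m, hm⟩ := ha i
    exact ⟨-m, by push_cast; rw [← hm]; rfl⟩

/-- The torus `T² = ℝ²/ℤ²`, with the quotient (Euclidean) metric. -/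
abbrev T2 : Type := R2 ⧸ intLattice

/-- The covering projection `π : ℝ² → T²`. -/
def pr : R2 → T2 := QuotientAddGroup.mk

instance : MeasurableSpace T2 := borel T2
instance : BorelSpace T2 := ⟨rfl⟩

/-- A fundamental domain `[0,1)²` for the lattice action. -/
def fundDomain : Set R2 := {x : R2 | ∀ i, x i ∈ Set.Ico (0 : ℝ) 1}

/-- Lebesgue (Haar) probability measure on the torus `T²`. -/
def lebT2 : Measure T2 := Measure.map pr (volume.restrict fundDomain)

/-- `F : ℝ² → ℝ²` is a lift of `f : T² → T²` if `π ∘ F = f ∘ π` and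
`F (x + w) = F x + w` for every lattice vector `w ∈ ℤ²`. -/
structure IsLift (f : T2 ≃ₜ T2) (F : R2 ≃ₜ R2) : Prop where
  proj : ∀ x : R2, pr (F x) = f (pr x)
  equivariant : ∀ x : R2, ∀ w ∈ intLattice, F (x + w) = F x + w

/-- `Homeo₀(T²)`: homeomorphisms of the torus isotopic to the identity,
characterized as those admitting a lift commuting with integer translations. -/
def Homeo0 : Set (T2 ≃ₜ T2) := {f | ∃ F : R2 ≃ₜ R2, IsLift f F}

/-- `Homeo_{0,λ}(T²)`: elements of `Homeo₀(T²)` preserving Lebesgue measure. -/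
def Homeo0Leb : Set (T2 ≃ₜ T2) :=
  {f | f ∈ Homeo0 ∧ MeasurePreserving f lebT2 lebT2}

/-- The uniform `C⁰` distance `d_{C⁰}(f,g) = sup_x d(f(x), g(x))` on torus maps. -/
def dC0 (f g : T2 ≃ₜ T2) : ℝ := ⨆ x : T2, dist (f x) (g x)

/-- The uniform distance `sup_{x ∈ ℝ²} ‖F(x) − G(x)‖` between maps of the plane. -/
def supDist (F G : R2 → R2) : ℝ := ⨆ x : R2, dist (F x) (G x)

/-- The rotation set `ρ(F̃)` of a lift: all limits `(F̃^{n_k}(z_k) − z_k)/n_k`. -/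
def rotSet (F : R2 ≃ₜ R2) : Set R2 :=
  {v | ∃ (z : ℕ → R2) (n : ℕ → ℕ), Tendsto n atTop atTop ∧
    Tendsto (fun k => (n k : ℝ)⁻¹ • ((⇑F)^[n k] (z k) - z k)) atTop (𝓝 v)}

/-- The rotation set of `f`, with fixed lift `F`, is `δ`-upper-stable in `H`. -/
def UpperStable (H : Set (T2 ≃ₜ T2)) (F : R2 ≃ₜ R2) (δ : ℝ) : Prop :=
  ∀ g ∈ H, ∀ G : R2 ≃ₜ R2, IsLift g G → supDist (⇑F) (⇑G) < δ →
    rotSet G ⊆ rotSet F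

/-- The rotation set of `f`, with fixed lift `F`, is `δ`-stable in `H`. -/
def StableRS (H : Set (T2 ≃ₜ T2)) (F : R2 ≃ₜ R2) (δ : ℝ) : Prop :=
  ∀ g ∈ H, ∀ G : R2 ≃ₜ R2, IsLift g G → supDist (⇑F) (⇑G) < δ →
    rotSet G = rotSet F

/-- `f` has a stable rotation set in `H`. -/
def HasStableRotSet (H : Set (T2 ≃ₜ T2)) (f : T2 ≃ₜ T2) : Prop :=
  ∃ F : R2 ≃ₜ R2, IsLift f F ∧ ∃ δ > 0, StableRS H F δ

/-- `S` is open in `H` for the uniform `C⁰` topology. -/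
def OpenIn (H S : Set (T2 ≃ₜ T2)) : Prop :=
  ∀ f ∈ S ∩ H, ∃ δ > 0, ∀ g ∈ H, dC0 f g < δ → g ∈ S

/-- `S` is dense in `H` for the uniform `C⁰` topology. -/
def DenseIn (H S : Set (T2 ≃ₜ T2)) : Prop :=
  ∀ f ∈ H, ∀ ε > 0, ∃ g ∈ S ∩ H, dC0 f g < ε

/-- `(x_i)_{0 ≤ i ≤ n}` is a finite `ε`-pseudo-orbit of `F`. -/
def IsPseudoOrbitUpTo (F : R2 → R2) (ε : ℝ) (x : ℕ → R2) (n : ℕ) : Prop :=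
  ∀ i < n, dist (F (x i)) (x (i + 1)) < ε

/-- `(x_i)_{i ∈ ℕ}` is an infinite `ε`-pseudo-orbit of `F`. -/
def IsPseudoOrbit (F : R2 → R2) (ε : ℝ) (x : ℕ → R2) : Prop :=
  ∀ i : ℕ, dist (F (x i)) (x (i + 1)) < ε

/-- The `ε`-pseudo-rotation set `ρ_ε(F̃)`. -/
def pseudoRotSet (F : R2 → R2) (ε : ℝ) : Set R2 :=
  {v | ∃ (n : ℕ → ℕ) (x : ℕ → ℕ → R2), Tendsto n atTop atTop ∧
    (∀ k, IsPseudoOrbitUpTo F ε (x k) (n k)) ∧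
    Tendsto (fun k => (n k : ℝ)⁻¹ • (x k (n k) - x k 0)) atTop (𝓝 v)}

/-- The oscillation `osc(f) = sup_{x,y} ‖(F(x) − x) − (F(y) − y)‖` of a lift. -/
def osc (F : R2 → R2) : ℝ := ⨆ p : R2 × R2, ‖(F p.1 - p.1) - (F p.2 - p.2)‖

/-- `f` has the shadowing property. -/
def Shadowing (f : T2 ≃ₜ T2) : Prop :=
  ∀ ε > 0, ∃ δ > 0, ∀ x : ℕ → T2, (∀ i, dist (f (x i)) (x (i + 1)) < δ) →
    ∃ z : T2, ∀ i, dist ((⇑f)^[i] z) (x i) < ε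

/-- `v ∈ ℚ² ⊂ ℝ²`. -/
def IsRationalPoint (v : R2) : Prop := ∀ i, ∃ q : ℚ, v i = (q : ℝ)


/-- equivariance under lattice translations -/
def Eqv (G : R2 ≃ₜ R2) : Prop := ∀ x : R2, ∀ w ∈ intLattice, G (x + w) = G x + w

lemma Eqv.iter {G : R2 ≃ₜ R2} (hG : Eqv G) (n : ℕ) (x w : R2) (hw : w ∈ intLattice) :
    (⇑G)^[n] (x + w) = (⇑G)^[n] x + w := by
  induction n with
  | zero => simp
  | succ k ih => rw [Function.iterate_succ_apply', ih, hG _ _ hw, Function.iterate_succ_apply']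

lemma Eqv.trans {G H : R2 ≃ₜ R2} (hG : Eqv G) (hH : Eqv H) : Eqv (G.trans H) := by
  intro x w hw
  simp [hG x w hw, hH _ w hw]

lemma Eqv.symm {G : R2 ≃ₜ R2} (hG : Eqv G) : Eqv G.symm := by
  intro x w hw
  apply G.injective
  rw [hG _ _ hw]; simp

/-- integer part -/
def ipart (x : R2) : R2 := !₂[(⌊x 0⌋ : ℝ), (⌊x 1⌋ : ℝ)]

lemma ipart_mem (x : R2) : ipart x ∈ intLattice := by
  intro i
  fin_cases i
  · exact ⟨⌊x 0⌋, by simp [ipart]⟩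
  · exact ⟨⌊x 1⌋, by simp [ipart]⟩

lemma fpart_mem (x : R2) : x - ipart x ∈ fundDomain := by
  intro i
  fin_cases i
  · simpa [ipart] using Int.fract_lt_one (x 0)
  · simpa [ipart] using Int.fract_lt_one (x 1)

lemma norm_le_of_coord {x : R2} {c : ℝ} (h0 : |x 0| ≤ c) (h1 : |x 1| ≤ c) : ‖x‖ ≤ 2 * c := by
  have hc : 0 ≤ c := (abs_nonneg _).trans h0
  rw [EuclideanSpace.norm_eq, Fin.sum_univ_two]
  apply Real.sqrt_le_iff.2
  refine ⟨by positivity, ?_⟩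
  have := sq_abs (x 0)
  have := sq_abs (x 1)
  have := pow_le_pow_left₀ (abs_nonneg _) h0 2
  have := pow_le_pow_left₀ (abs_nonneg _) h1 2
  simp only [Real.norm_eq_abs]
  nlinarith

lemma coord_le_norm (x : R2) (i : Fin 2) : |x i| ≤ ‖x‖ := by
  simpa using EuclideanSpace.norm_eq x ▸ (Real.abs_le_sqrt (by
    have := Finset.single_le_sum (f := fun j => ‖x j‖ ^ 2) (fun j _ => by positivity) (Finset.mem_univ i)
    simpa using this) : |x i| ≤ √(∑ i, ‖x i‖ ^ 2))

lemma fund_norm_le {x y : R2} (hx : x ∈ fundDomain) (hy : y ∈ fundDomain) : ‖x - y‖ ≤ 2 := by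
  have := norm_le_of_coord (x := x - y) (c := 1) ?_ ?_
  · linarith
  · have h1 := hx 0; have h2 := hy 0
    simp only [PiLp.sub_apply]
    rw [abs_le]; constructor <;> linarith [h1.1, h1.2, h2.1, h2.2]
  · have h1 := hx 1; have h2 := hy 1
    simp only [PiLp.sub_apply]
    rw [abs_le]; constructor <;> linarith [h1.1, h1.2, h2.1, h2.2]

lemma lattice_norm_lt_one {w : R2} (hw : w ∈ intLattice) (h : ‖w‖ < 1) : w = 0 := by
  ext i
  obtain ⟨n, hn⟩ := hw i
  have := (coord_le_norm w i).trans_lt h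
  rw [hn] at this
  have h2 : |n| < 1 := by
    have h3 : ((|n| : ℤ) : ℝ) < ((1 : ℤ) : ℝ) := by push_cast; exact this
    exact Int.cast_lt.1 h3
  rw [hn]
  simp [Int.abs_lt_one_iff.1 h2]

lemma Eqv.bdd {G : R2 ≃ₜ R2} (hG : Eqv G) : ∃ C : ℝ, 0 ≤ C ∧ ∀ x, ‖G x - x‖ ≤ C := by
  have hc : IsCompact (closedBall (0 : R2) 2) := isCompact_closedBall _ _
  obtain ⟨C, hC⟩ := hc.exists_bound_of_continuousOn (f := fun x => G x - x)
    (by have := G.continuous; fun_prop)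
  refine ⟨max C 0, le_max_right _ _, fun x => ?_⟩
  have h1 : x = (x - ipart x) + ipart x := by abel
  have h0 : (0 : R2) ∈ fundDomain := by intro i; simp
  have := hC (x - ipart x) (by
    rw [mem_closedBall, dist_eq_norm]
    exact fund_norm_le (fpart_mem x) h0)
  have e : G x - x = G (x - ipart x) - (x - ipart x) := by
    conv_lhs => rw [h1, hG _ _ (ipart_mem x)]
    abel
  rw [e]; exact this.trans (le_max_left _ _)

lemma iter_bdd {G : R2 ≃ₜ R2} {C : ℝ} (hC : ∀ x, ‖G x - x‖ ≤ C) (n : ℕ) (x : R2) :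
    ‖(⇑G)^[n] x - x‖ ≤ n * C := by
  induction n with
  | zero => simp
  | succ k ih =>
    rw [Function.iterate_succ_apply']
    have : G ((⇑G)^[k] x) - x = (G ((⇑G)^[k] x) - (⇑G)^[k] x) + ((⇑G)^[k] x - x) := by abel
    rw [this]
    have := norm_add_le (G ((⇑G)^[k] x) - (⇑G)^[k] x) ((⇑G)^[k] x - x)
    have := hC ((⇑G)^[k] x)
    push_cast
    linarith

lemma rotSet_bdd {G : R2 ≃ₜ R2} {C : ℝ} (hC : ∀ x, ‖G x - x‖ ≤ C) {v : R2} (hv : v ∈ rotSet G) :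
    ‖v‖ ≤ C := by
  obtain ⟨z, n, hn, ht⟩ := hv
  refine le_of_tendsto ht.norm ?_
  filter_upwards [hn.eventually_ge_atTop 1] with k hk
  have := iter_bdd hC (n k) (z k)
  have h1 : (0 : ℝ) < n k := by exact_mod_cast hk
  rw [norm_smul, norm_inv, Real.norm_natCast, inv_mul_le_iff₀ h1]
  exact this

lemma pr_eq_iff {x y : R2} : pr x = pr y ↔ y - x ∈ intLattice := by
  unfold pr
  rw [QuotientAddGroup.eq]
  have : -x + y = y - x := by abel
  rw [this]

lemma Eqv.exists_torus {G : R2 ≃ₜ R2} (hG : Eqv G) : ∃ g : T2 ≃ₜ T2, IsLift g G := by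
  have key : ∀ H : R2 ≃ₜ R2, Eqv H → ∃ h : T2 → T2, Continuous h ∧ ∀ x, h (pr x) = pr (H x) := by
    intro H hH
    have hwd : ∀ x y : R2, pr x = pr y → pr (H x) = pr (H y) := by
      intro x y hxy
      rw [pr_eq_iff] at hxy ⊢
      have := hH x _ hxy
      rw [add_sub_cancel] at this
      rw [this, add_sub_cancel_left]; exact hxy
    refine ⟨Quotient.lift (fun x => pr (H x)) (fun x y hxy => hwd x y (Quotient.sound hxy)), ?_, fun x => rfl⟩
    apply Continuous.quotient_lift
    exact (continuous_quotient_mk').comp H.continuous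
  obtain ⟨g, hg, hg'⟩ := key G hG
  obtain ⟨k, hk, hk'⟩ := key G.symm hG.symm
  have hs : ∀ y : T2, ∃ x, pr x = y := fun y => Quotient.exists_rep y
  refine ⟨⟨⟨g, k, ?_, ?_⟩, hg, hk⟩, ⟨fun x => (hg' x).symm, hG⟩⟩
  · intro y; obtain ⟨x, rfl⟩ := hs y; rw [hg', hk']; simp
  · intro y; obtain ⟨x, rfl⟩ := hs y; rw [hk', hg']; simp

lemma iter_shift {G H : R2 ≃ₜ R2} (hG : Eqv G) {w : R2} (hw : w ∈ intLattice)
    (h : ∀ x, H x = G x + w) (n : ℕ) (x : R2) : (⇑H)^[n] x = (⇑G)^[n] x + (n : ℝ) • w := by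
  induction n with
  | zero => simp
  | succ k ih =>
    rw [Function.iterate_succ_apply', ih, h, Function.iterate_succ_apply']
    have hk : (k : ℝ) • w ∈ intLattice := by
      rw [Nat.cast_smul_eq_nsmul]; exact intLattice.nsmul_mem hw k
    rw [hG _ _ hk]; push_cast; rw [add_smul, one_smul, add_assoc]

lemma rotSet_shift {G H : R2 ≃ₜ R2} (hG : Eqv G) {w : R2} (hw : w ∈ intLattice)
    (h : ∀ x, H x = G x + w) {v : R2} (hv : v ∈ rotSet G) : v + w ∈ rotSet H := by
  obtain ⟨z, n, hn, ht⟩ := hv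
  refine ⟨z, n, hn, ?_⟩
  refine (ht.add_const w).congr' ?_
  filter_upwards [hn.eventually_ge_atTop 1] with k hk
  have h1 : (n k : ℝ) ≠ 0 := by positivity
  rw [iter_shift hG hw h, add_sub_right_comm, smul_add, inv_smul_smul₀ h1]

lemma lifts_differ {f : T2 ≃ₜ T2} {F G : R2 ≃ₜ R2} (hF : IsLift f F) (hG : IsLift f G) :
    ∃ w ∈ intLattice, ∀ x, G x = F x + w := by
  have hm : ∀ x, G x - F x ∈ intLattice := fun x => by
    rw [← pr_eq_iff, hF.proj, hG.proj]
  have hconst : ∀ i : Fin 2, ∀ x : R2, (G x - F x) i = (G 0 - F 0) i := by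
    intro i x
    choose m hm' using fun x => hm x i
    have hc : Continuous fun x => ((m x : ℤ) : ℝ) := by
      have : (fun x => ((m x : ℤ) : ℝ)) = fun x => (G x - F x) i := by
        ext x; rw [hm']
      rw [this]
      have := G.continuous; have := F.continuous; fun_prop
    have hc' : Continuous m := Int.isClosedEmbedding_coe_real.isEmbedding.continuous_iff.2 hc
    rw [hm', hm']
    exact congrArg _ (PreconnectedSpace.constant inferInstance hc')
  refine ⟨G 0 - F 0, hm 0, fun x => ?_⟩
  have : G x - F x = G 0 - F 0 := by ext i; exact hconst i x
  rw [← this]; abel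

/-- working form of stability -/
def Stab (F : R2 ≃ₜ R2) (δ : ℝ) : Prop :=
  ∀ G : R2 ≃ₜ R2, Eqv G → ∀ ε : ℝ, (∀ x, dist (F x) (G x) ≤ ε) → ε < δ → rotSet G ⊆ rotSet F

lemma stab_of {f : T2 ≃ₜ T2} {δ : ℝ} {F₀ F : R2 ≃ₜ R2} (h₀ : IsLift f F₀)
    (hs : UpperStable Homeo0 F₀ δ) (hF : IsLift f F) : Stab F δ := by
  obtain ⟨w, hw, h⟩ := lifts_differ h₀ hF
  intro G hG ε hε hεδ v hv
  have hsh : Eqv (Homeomorph.addRight (-w)) := by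
    intro x u _; simp only [Homeomorph.coe_addRight]; abel
  have hw' := intLattice.neg_mem hw
  set G' := G.trans (Homeomorph.addRight (-w)) with hG'
  have hG'e : Eqv G' := hG.trans hsh
  have hG'v : ∀ x, G' x = G x + -w := fun x => by simp [hG']
  obtain ⟨g, hg⟩ := hG'e.exists_torus
  have h1 := hs g ⟨G', hg⟩ G' hg (by
    refine lt_of_le_of_lt (ciSup_le fun x => ?_) hεδ
    have := hε x
    rw [h] at this
    have e : dist (F₀ x) (G' x) = dist (F₀ x + w) (G x) := by
      rw [hG'v, dist_eq_norm, dist_eq_norm]; congr 1; abel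
    exact e.trans_le this)
  have h2 := rotSet_shift h₀.equivariant hw h (h1 (rotSet_shift hG hw' hG'v hv))
  simpa using h2

lemma rotSet_nonempty {F : R2 ≃ₜ R2} (hF : Eqv F) : (rotSet F).Nonempty := by
  obtain ⟨C, hC0, hC⟩ := hF.bdd
  have hb : ∀ n : ℕ, ((n : ℝ)⁻¹ • ((⇑F)^[n] 0 - 0)) ∈ closedBall (0 : R2) C := by
    intro n
    rw [mem_closedBall, dist_zero_right, norm_smul, norm_inv, Real.norm_natCast]
    rcases Nat.eq_zero_or_pos n with rfl | hn
    · simpa using hC0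
    · have h1 : (0 : ℝ) < n := by exact_mod_cast hn
      rw [inv_mul_le_iff₀ h1]; exact iter_bdd hC n 0
  obtain ⟨v, -, φ, hφ, ht⟩ := (isCompact_closedBall (0 : R2) C).tendsto_subseq hb
  exact ⟨v, fun _ => 0, φ, hφ.tendsto_atTop, ht⟩

lemma stab_le_one {F : R2 ≃ₜ R2} (hF : Eqv F) {δ : ℝ} (hs : Stab F δ) : δ ≤ 1 := by
  by_contra hδ
  push Not at hδ
  set w : R2 := !₂[1, 0] with hw
  have hwm : w ∈ intLattice := by
    intro i; fin_cases i
    · exact ⟨1, by simp [hw]⟩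
    · exact ⟨0, by simp [hw]⟩
  have hwn : ‖w‖ = 1 := by simp [hw, EuclideanSpace.norm_eq]
  set G := F.trans (Homeomorph.addRight w)
  have hGv : ∀ x, G x = F x + w := fun x => by simp [G]
  have hG : Eqv G := by
    intro x u hu; rw [hGv, hGv, hF x u hu]; abel
  have hsub := hs G hG 1 (fun x => by rw [hGv, dist_eq_norm]; simp [hwn]) hδ
  obtain ⟨v, hv⟩ := rotSet_nonempty hF
  obtain ⟨C, hC0, hC⟩ := hF.bdd
  have hk : ∀ k : ℕ, v + (k : ℝ) • w ∈ rotSet F := by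
    intro k
    induction k with
    | zero => simpa using hv
    | succ k ih =>
      have := hsub (rotSet_shift hF hwm hGv ih)
      push_cast; rw [add_smul, one_smul, ← add_assoc]; exact this
  obtain ⟨k, hk'⟩ := exists_nat_gt (C + ‖v‖)
  have h1 := rotSet_bdd hC (hk k)
  have h2 : ‖(k : ℝ) • w‖ = k := by rw [norm_smul, hwn]; simp
  have h3 : ‖(k : ℝ) • w‖ ≤ ‖v + (k : ℝ) • w‖ + ‖v‖ := by
    have := norm_sub_le (v + (k : ℝ) • w) v
    simpa using this
  linarith

lemma exp_const {φ : ℝ → ℂ} (hφ : Continuous φ) {c : ℂ} (h : ∀ t, Complex.exp (φ t) = c) :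
    φ 0 = φ 1 := by
  have h1 : ∀ t, ∃ n : ℤ, φ t = φ 0 + n * (2 * Real.pi * Complex.I) := fun t =>
    Complex.exp_eq_exp_iff_exists_int.1 ((h t).trans (h 0).symm)
  choose n hn using h1
  have hne : (2 * Real.pi * Complex.I : ℂ) ≠ 0 := Complex.two_pi_I_ne_zero
  have hc : Continuous fun t => ((n t : ℤ) : ℝ) := by
    have : (fun t => ((n t : ℤ) : ℝ)) = fun t => ((φ t - φ 0) / (2 * Real.pi * Complex.I)).re := by
      ext t
      rw [hn t, add_sub_cancel_left, mul_div_cancel_right₀ _ hne]; simp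
    rw [this]
    fun_prop
  have hc' : Continuous n := Int.isClosedEmbedding_coe_real.isEmbedding.continuous_iff.2 hc
  have h0 := hn 1
  have e : n 1 = n 0 := PreconnectedSpace.constant inferInstance hc'
  rw [h0, e]
  exact hn 0

lemma cpx_mid {γ : ℝ → ℂ} (hγ : Continuous γ) (U : ℂ) (hU : ∀ s t, γ t - γ s ≠ U)
    (hd : ∀ t, ‖U - (γ 1 - γ 0) / 2‖ < ‖γ t - (γ 0 + γ 1) / 2‖) : False := by
  obtain ⟨L, ⟨-, hL⟩, -⟩ := Complex.isCoveringMapOn_exp.existsUnique_continuousMap_lifts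
    (A := ℝ × ℝ) (a₀ := (0, 0)) (e₀ := Complex.log (γ 0 - γ 0 - U))
    ⟨fun p : ℝ × ℝ => γ p.2 - γ p.1 - U, by fun_prop⟩
    (by
      simp only [ContinuousMap.coe_mk]
      exact Complex.exp_log (sub_ne_zero.2 (hU 0 0)))
    (fun p => sub_ne_zero.2 (hU _ _))
  have hL' : ∀ s t, Complex.exp (L (s, t)) = γ t - γ s - U := fun s t => congrFun hL (s, t)
  have hLc : Continuous L := L.continuous
  set y := (γ 0 + γ 1) / 2 with hy
  set m := (γ 1 - γ 0) / 2 with hm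
  have hg : ∀ t, γ t - y ≠ 0 := fun t h => by
    have := hd t
    rw [h, norm_zero] at this
    exact absurd this (not_lt.2 (norm_nonneg _))
  set e : ℝ → ℂ := fun t => (m - U) / (γ t - y) with he
  have he1 : ∀ t, ‖e t‖ < 1 := fun t => by
    simp only [he]
    rw [norm_div, div_lt_one (norm_pos_iff.2 (hg t)), norm_sub_rev]
    exact hd t
  have hec : Continuous e := by
    simp only [he]
    exact Continuous.div (by fun_prop) (by fun_prop) hg
  have hslit : ∀ z : ℂ, ‖z‖ < 1 → 1 + z ∈ Complex.slitPlane := fun z hz =>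
    Complex.mem_slitPlane_of_norm_lt_one hz
  have hs1 : ∀ t, 1 + e t ∈ Complex.slitPlane := fun t => hslit _ (he1 t)
  have hs2 : ∀ t, 1 - e t ∈ Complex.slitPlane := fun t => by
    rw [sub_eq_add_neg]; exact hslit _ (by rw [norm_neg]; exact he1 t)
  have hc1 : Continuous fun t => Complex.log (1 + e t) :=
    Continuous.clog (by fun_prop) hs1
  have hc2 : Continuous fun t => Complex.log (1 - e t) :=
    Continuous.clog (by fun_prop) hs2
  -- constant difference
  have hdiff := exp_const (φ := fun t => (L (0, t) - Complex.log (1 + e t))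
      - (L (t, 1) - Complex.log (1 - e t))) (by fun_prop) (c := -1) (fun t => by
    rw [Complex.exp_sub, Complex.exp_sub, Complex.exp_sub, hL', hL',
      Complex.exp_log (Complex.slitPlane_ne_zero (hs1 t)),
      Complex.exp_log (Complex.slitPlane_ne_zero (hs2 t))]
    have h1 : γ t - γ 0 - U = (γ t - y) * (1 + e t) := by
      simp only [he]; field_simp [hg t]; rw [hy, hm]; ring
    have h2 : γ 1 - γ t - U = -((γ t - y) * (1 - e t)) := by
      simp only [he]; field_simp [hg t]; rw [hy, hm]; ring
    have h3 := Complex.slitPlane_ne_zero (hs1 t)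
    have h4 := Complex.slitPlane_ne_zero (hs2 t)
    have h5 := hg t
    rw [h1, h2, mul_div_cancel_right₀ _ h3, neg_div, mul_div_cancel_right₀ _ h4, div_neg,
      div_self h5])
  have hdiag := exp_const (φ := fun t => L (t, t)) (by fun_prop) (c := -U) (fun t => by
    rw [hL']; ring)
  have hm0 : m ≠ 0 := by
    have := hg 1
    have e1 : γ 1 - y = m := by rw [hy, hm]; ring
    rwa [e1] at this
  have e0 : e 0 = - e 1 := by
    have e1 : γ 1 - y = m := by rw [hy, hm]; ring
    have e2 : γ 0 - y = -m := by rw [hy, hm]; ring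
    simp only [he]; rw [e1, e2, div_neg]
  have hfin : L (0, 1) - Complex.log (1 + e 1) = L (0, 0) - Complex.log (1 + e 0) := by
    rw [e0] at hdiff ⊢
    rw [sub_neg_eq_add] at hdiff
    rw [← sub_eq_add_neg] at *
    linear_combination (-1/2) * hdiff + (-1/2) * hdiag
  have hx := congrArg Complex.exp hfin
  rw [Complex.exp_sub, Complex.exp_sub, hL', hL', Complex.exp_log (Complex.slitPlane_ne_zero (hs1 1)),
      Complex.exp_log (Complex.slitPlane_ne_zero (hs1 0))] at hx
  have h1 : ∀ t, γ t - γ 0 - U = (γ t - y) * (1 + e t) := fun t => by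
    have := hg t
    simp only [he]; field_simp; rw [hy, hm]; ring
  rw [h1, h1, mul_div_cancel_right₀ _ (Complex.slitPlane_ne_zero (hs1 1)),
    mul_div_cancel_right₀ _ (Complex.slitPlane_ne_zero (hs1 0))] at hx
  apply hm0
  rw [hm]
  linear_combination (1/2) * hx

lemma exists_lattice_near (m : R2) : ∃ u ∈ intLattice, u ≠ 0 ∧ ‖u - m‖ ≤ 2 := by
  have h := fpart_mem m
  by_cases h0 : ipart m = 0
  · rw [h0, sub_zero] at h
    refine ⟨!₂[1, 0], ?_, ?_, ?_⟩
    · intro i; fin_cases i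
      · exact ⟨1, by simp⟩
      · exact ⟨0, by simp⟩
    · intro h; have := congrArg (fun v : R2 => v 0) h; simp at this
    · have a := h 0; have b := h 1
      have := norm_le_of_coord (x := !₂[1, 0] - m) (c := 1)
        (by simp; rw [abs_le]; constructor <;> linarith [a.1, a.2])
        (by simp; rw [abs_le]; constructor <;> linarith [b.1, b.2])
      linarith
  · refine ⟨ipart m, ipart_mem m, h0, ?_⟩
    rw [norm_sub_rev]
    have h00 : (0 : R2) ∈ fundDomain := by intro i; simp
    simpa using fund_norm_le h h00

lemma mid_lemma {h : R2 → R2} (hc : Continuous h) (hi : Function.Injective h)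
    (he : ∀ x, ∀ w ∈ intLattice, h (x + w) = h x + w) {a b : R2} (ha : a ∈ fundDomain)
    (hb : b ∈ fundDomain) : ∃ c ∈ fundDomain, ‖h c - (1/2 : ℝ) • (h a + h b)‖ ≤ 2 := by
  by_contra hcon
  push Not at hcon
  set J : R2 ≃ₗᵢ[ℝ] ℂ := Complex.orthonormalBasisOneI.repr.symm with hJ
  set α : ℝ → R2 := fun t => a + (max 0 (min t 1)) • (b - a) with hα
  have hα0 : α 0 = a := by simp [hα]
  have hα1 : α 1 = b := by simp [hα]
  have hαm : ∀ t, α t ∈ fundDomain := by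
    intro t i
    have h1 : 0 ≤ max 0 (min t 1) := le_max_left _ _
    have h2 : max 0 (min t 1) ≤ 1 := max_le zero_le_one (min_le_right _ _)
    have := convex_Ico (0 : ℝ) 1 (ha i) (hb i) (sub_nonneg.2 h2) h1 (by ring)
    have e : (α t) i = (1 - max 0 (min t 1)) • a i + (max 0 (min t 1)) • b i := by
      simp [hα]; ring
    rw [e]; exact this
  set γ : ℝ → ℂ := fun t => J (h (α t)) with hγ
  have hαc : Continuous α := by simp only [hα]; fun_prop
  have hγc : Continuous γ := by simp only [hγ]; exact J.continuous.comp (hc.comp hαc)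
  obtain ⟨u, hu, hu0, hun⟩ := exists_lattice_near ((1/2 : ℝ) • (h b - h a))
  refine cpx_mid hγc (J u) ?_ ?_
  · intro s t hst
    simp only [hγ] at hst
    rw [← map_sub] at hst
    have h1 := J.injective hst
    have h2 : h (α t) = h (α s + u) := by rw [he _ _ hu, ← h1]; abel
    have h3 := hi h2
    have h4 : u = α t - α s := by rw [h3]; abel
    apply hu0
    ext i
    obtain ⟨n, hn⟩ := hu i
    have h5 : (n : ℝ) = α t i - α s i := by rw [← hn, h4]; simp
    have x1 := hαm t i; have x2 := hαm s i
    have h6 : (n : ℝ) < 1 := by linarith [x1.2, x2.1]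
    have h7 : (-1 : ℝ) < n := by linarith [x1.1, x2.2]
    have h8 : n < 1 := by exact_mod_cast h6
    have h9 : -1 < n := by exact_mod_cast h7
    have : n = 0 := by omega
    rw [hn, this]; simp
  · intro t
    have e1 : J u - (γ 1 - γ 0) / 2 = J (u - (1/2 : ℝ) • (h b - h a)) := by
      simp only [hγ, hα0, hα1, map_sub, map_smul, Complex.real_smul]; push_cast; ring
    have e2 : γ t - (γ 0 + γ 1) / 2 = J (h (α t) - (1/2 : ℝ) • (h a + h b)) := by
      simp only [hγ, hα0, hα1, map_sub, map_add, map_smul, Complex.real_smul]; push_cast; ring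
    rw [e1, e2, J.norm_map, J.norm_map]
    exact hun.trans_lt (hcon _ (hαm t))

lemma iter_mul_le {F : R2 ≃ₜ R2} (ℓ : R2 →L[ℝ] ℝ) {n : ℕ} {c : ℝ}
    (h : ∀ x, ℓ ((⇑F)^[n] x - x) ≤ n * c) (q : ℕ) (x : R2) :
    ℓ ((⇑F)^[n * q] x - x) ≤ q * (n * c) := by
  induction q with
  | zero => simp
  | succ q ih =>
    have e : n * (q + 1) = n + n * q := by ring
    rw [e, Function.iterate_add_apply]
    have : (⇑F)^[n] ((⇑F)^[n * q] x) - x =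
      ((⇑F)^[n] ((⇑F)^[n * q] x) - (⇑F)^[n * q] x) + ((⇑F)^[n * q] x - x) := by abel
    rw [this, map_add]
    have := h ((⇑F)^[n * q] x)
    push_cast
    linarith

lemma rot_le {F : R2 ≃ₜ R2} (hF : Eqv F) (ℓ : R2 →L[ℝ] ℝ) {n : ℕ} (hn : 1 ≤ n) {c : ℝ}
    (h : ∀ x, ℓ ((⇑F)^[n] x - x) ≤ n * c) {v : R2} (hv : v ∈ rotSet F) : ℓ v ≤ c := by
  obtain ⟨C, hC0, hC⟩ := hF.bdd
  set B : ℝ := n * |c| + ‖ℓ‖ * (n * C) with hB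
  have key : ∀ N x, ℓ ((⇑F)^[N] x - x) ≤ N * c + B := by
    intro N x
    have hN := Nat.div_add_mod N n
    have hr : N % n < n := Nat.mod_lt _ hn
    set r := N % n
    set q := N / n
    have e : (⇑F)^[N] x - x = ((⇑F)^[n * q] ((⇑F)^[r] x) - (⇑F)^[r] x) + ((⇑F)^[r] x - x) := by
      rw [← hN, Function.iterate_add_apply]; abel
    rw [e, map_add]
    have h1 := iter_mul_le ℓ h q ((⇑F)^[r] x)
    have h2 : ℓ ((⇑F)^[r] x - x) ≤ ‖ℓ‖ * (n * C) := by
      refine (le_abs_self _).trans ((ℓ.le_opNorm _).trans ?_)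
      refine mul_le_mul_of_nonneg_left ((iter_bdd hC r x).trans ?_) (norm_nonneg _)
      have : (r : ℝ) ≤ n := by exact_mod_cast hr.le
      nlinarith
    have h3 : (N : ℝ) = n * q + r := by rw [← hN]; push_cast; ring
    have h4 : -((r : ℝ) * c) ≤ n * |c| := by
      have : (r : ℝ) ≤ n := by exact_mod_cast hr.le
      have h5 : -c ≤ |c| := neg_le_abs c
      have : (0 : ℝ) ≤ r := Nat.cast_nonneg _
      nlinarith [abs_nonneg c]
    rw [h3, hB]; linarith
  obtain ⟨z, m, hm, ht⟩ := hv
  have h1 : Tendsto (fun k => c + B * (m k : ℝ)⁻¹) atTop (𝓝 (c + B * 0)) := by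
    refine tendsto_const_nhds.add (Tendsto.const_mul _ ?_)
    exact tendsto_inv_atTop_zero.comp (tendsto_natCast_atTop_atTop.comp hm)
  rw [mul_zero, add_zero] at h1
  refine le_of_tendsto_of_tendsto ((ℓ.continuous.tendsto v).comp ht) h1 ?_
  filter_upwards [hm.eventually_ge_atTop 1] with k hk
  have h1 : (0 : ℝ) < m k := by exact_mod_cast hk
  simp only [Function.comp, map_smul, smul_eq_mul]
  rw [inv_mul_le_iff₀ h1]
  have := key (m k) (z k)
  have e : (m k : ℝ) * (c + B * (m k : ℝ)⁻¹) = m k * c + B := by field_simp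
  rw [e]; exact this

lemma convex_of_mid {L : Set R2} (hc : IsClosed L)
    (hm : ∀ x ∈ L, ∀ y ∈ L, (1/2 : ℝ) • (x + y) ∈ L) : Convex ℝ L := by
  rw [convex_iff_segment_subset]
  intro x hx y hy z hz
  rw [segment_eq_image_lineMap] at hz
  obtain ⟨t, ht, rfl⟩ := hz
  set T : Set ℝ := Icc 0 1 ∩ {s | AffineMap.lineMap x y s ∈ L} with hT
  have hTc : IsCompact T := by
    refine isCompact_Icc.inter_right (hc.preimage ?_)
    exact AffineMap.lineMap_continuous
  by_contra hcon
  have hA : IsCompact (T ∩ Iic t) := hTc.inter_right isClosed_Iic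
  have hB : IsCompact (T ∩ Ici t) := hTc.inter_right isClosed_Ici
  have hA0 : (0 : ℝ) ∈ T ∩ Iic t := ⟨⟨by simp, by simpa using hx⟩, ht.1⟩
  have hB0 : (1 : ℝ) ∈ T ∩ Ici t := ⟨⟨by simp, by simpa using hy⟩, ht.2⟩
  obtain ⟨p, hp, hpm⟩ := hA.exists_isGreatest ⟨_, hA0⟩
  obtain ⟨q, hq, hqm⟩ := hB.exists_isLeast ⟨_, hB0⟩
  have hpt : p ≠ t := fun h => hcon (h ▸ hp.1.2)
  have hqt : q ≠ t := fun h => hcon (h ▸ hq.1.2)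
  have h1 : p < t := lt_of_le_of_ne hp.2 hpt
  have h2 : t < q := lt_of_le_of_ne hq.2 (Ne.symm hqt)
  have hmid : (p + q) / 2 ∈ T := by
    refine ⟨⟨by linarith [hp.1.1.1, hq.1.1.1], by linarith [hp.1.1.2, hq.1.1.2]⟩, ?_⟩
    have := hm _ hp.1.2 _ hq.1.2
    simp only [mem_setOf_eq]
    convert this using 1
    simp only [AffineMap.lineMap_apply_module']
    module
  rcases le_total ((p + q) / 2) t with h | h
  · have := hpm ⟨hmid, h⟩; linarith
  · have := hqm ⟨hmid, h⟩; linarith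

/-- ultrafilter limit set -/
def LU (F : R2 ≃ₜ R2) : Set R2 :=
  {v | ∀ ε > 0, ∀ᶠ n : ℕ in (hyperfilter ℕ : Filter ℕ), ∃ x ∈ fundDomain,
    ‖(n : ℝ)⁻¹ • ((⇑F)^[n] x - x) - v‖ < ε}

lemma hyper_ge (N : ℕ) : ∀ᶠ n : ℕ in (hyperfilter ℕ : Filter ℕ), N ≤ n := by
  have : (hyperfilter ℕ : Filter ℕ) ≤ atTop := Nat.cofinite_eq_atTop ▸ hyperfilter_le_cofinite
  exact this (eventually_ge_atTop N)

lemma LU_closed (F : R2 ≃ₜ R2) : IsClosed (LU F) := by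
  rw [← isSeqClosed_iff_isClosed]
  intro s v hs hv ε hε
  obtain ⟨k, hk⟩ := ((Metric.tendsto_atTop.1 hv) (ε/2) (by positivity))
  filter_upwards [hs k (ε/2) (by positivity)] with n hn
  obtain ⟨x, hx, h⟩ := hn
  refine ⟨x, hx, ?_⟩
  have := hk k le_rfl
  rw [dist_eq_norm] at this
  have h2 := norm_add_le ((n : ℝ)⁻¹ • ((⇑F)^[n] x - x) - s k) (s k - v)
  rw [sub_add_sub_cancel] at h2
  linarith

lemma LU_mid {F : R2 ≃ₜ R2} (hF : Eqv F) : ∀ x ∈ LU F, ∀ y ∈ LU F, (1/2 : ℝ) • (x + y) ∈ LU F := by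
  intro v hv w hw ε hε
  obtain ⟨N, hN⟩ := exists_nat_gt (8 / ε)
  filter_upwards [hv (ε/2) (by positivity), hw (ε/2) (by positivity), hyper_ge N, hyper_ge 1]
    with n hvn hwn hn hn1
  obtain ⟨a, ha, hav⟩ := hvn
  obtain ⟨b, hb, hbw⟩ := hwn
  obtain ⟨c, hc, hcm⟩ := mid_lemma (h := (⇑F)^[n]) (F.continuous.iterate n)
    (F.injective.iterate n) (fun x w hw => hF.iter n x w hw) ha hb
  refine ⟨c, hc, ?_⟩
  have hn0 : (0 : ℝ) < n := by exact_mod_cast hn1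
  set A := (n : ℝ)⁻¹ • ((⇑F)^[n] a - a) - v
  set B := (n : ℝ)⁻¹ • ((⇑F)^[n] b - b) - w
  have e : (n : ℝ)⁻¹ • ((⇑F)^[n] c - c) - (1/2 : ℝ) • (v + w) =
      (1/2 : ℝ) • A + (1/2 : ℝ) • B + ((n : ℝ)⁻¹ • ((⇑F)^[n] c - (1/2 : ℝ) • ((⇑F)^[n] a + (⇑F)^[n] b))
        + (n : ℝ)⁻¹ • ((1/2 : ℝ) • (a - c) + (1/2 : ℝ) • (b - c))) := by
    simp only [A, B]; module
  rw [e]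
  have n1 : ‖(1/2 : ℝ) • A‖ ≤ (1/2) * (ε/2) := by
    rw [norm_smul]; norm_num; linarith
  have n2 : ‖(1/2 : ℝ) • B‖ ≤ (1/2) * (ε/2) := by
    rw [norm_smul]; norm_num; linarith
  have n3 : ‖(n : ℝ)⁻¹ • ((⇑F)^[n] c - (1/2 : ℝ) • ((⇑F)^[n] a + (⇑F)^[n] b))‖ ≤ (n : ℝ)⁻¹ * 2 := by
    rw [norm_smul, norm_inv, Real.norm_natCast]; gcongr
  have n4 : ‖(n : ℝ)⁻¹ • ((1/2 : ℝ) • (a - c) + (1/2 : ℝ) • (b - c))‖ ≤ (n : ℝ)⁻¹ * 2 := by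
    rw [norm_smul, norm_inv, Real.norm_natCast]; gcongr
    refine (norm_add_le _ _).trans ?_
    rw [norm_smul, norm_smul]
    have := fund_norm_le ha hc
    have := fund_norm_le hb hc
    norm_num; linarith
  have n5 : (n : ℝ)⁻¹ * 2 < ε / 4 := by
    have h8 : 8 / ε < n := hN.trans_le (by exact_mod_cast hn)
    rw [div_lt_iff₀ hε] at h8
    rw [inv_mul_lt_iff₀ hn0]; linarith
  have := norm_add₃_le (a := (1/2 : ℝ) • A) (b := (1/2 : ℝ) • B)
    (c := ((n : ℝ)⁻¹ • ((⇑F)^[n] c - (1/2 : ℝ) • ((⇑F)^[n] a + (⇑F)^[n] b))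
        + (n : ℝ)⁻¹ • ((1/2 : ℝ) • (a - c) + (1/2 : ℝ) • (b - c))))
  have := norm_add_le ((n : ℝ)⁻¹ • ((⇑F)^[n] c - (1/2 : ℝ) • ((⇑F)^[n] a + (⇑F)^[n] b)))
    ((n : ℝ)⁻¹ • ((1/2 : ℝ) • (a - c) + (1/2 : ℝ) • (b - c)))
  linarith

lemma rotSet_eq_LU {F : R2 ≃ₜ R2} (hF : Eqv F) : rotSet F = LU F := by
  apply Subset.antisymm
  · intro v hv
    by_contra hcon
    obtain ⟨ℓ, c, h1, h2⟩ := geometric_hahn_banach_closed_point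
      (convex_of_mid (LU_closed F) (LU_mid hF)) (LU_closed F) hcon
    obtain ⟨C, hC0, hC⟩ := hF.bdd
    have hx : ∀ n : ℕ, ∃ x ∈ fundDomain, 1 ≤ n → n * c < ℓ ((⇑F)^[n] x - x) := by
      intro n
      by_cases hn : 1 ≤ n
      · by_contra hcon2
        push Not at hcon2
        refine absurd (rot_le hF ℓ hn (c := c) (fun x => ?_) hv) (not_le.2 h2)
        have := (hcon2 _ (fpart_mem x)).2
        have e := hF.iter n (x - ipart x) _ (ipart_mem x)
        rw [sub_add_cancel] at e
        have e2 : (⇑F)^[n] x - x = (⇑F)^[n] (x - ipart x) - (x - ipart x) := by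
          rw [e]; abel
        rw [e2]; exact this
      · exact ⟨0, fun i => by simp, fun h => absurd h hn⟩
    choose x hxf hx using hx
    set s : ℕ → R2 := fun n => (n : ℝ)⁻¹ • ((⇑F)^[n] (x n) - x n) with hs
    have hb : ∀ n : ℕ, s n ∈ closedBall (0 : R2) C := by
      intro n
      rw [mem_closedBall, dist_zero_right, norm_smul, norm_inv, Real.norm_natCast]
      rcases Nat.eq_zero_or_pos n with rfl | hn
      · simpa using hC0
      · have h1 : (0 : ℝ) < n := by exact_mod_cast hn
        rw [inv_mul_le_iff₀ h1]; exact iter_bdd hC n _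
    obtain ⟨p, -, hp⟩ := (isCompact_closedBall (0 : R2) C).ultrafilter_le_nhds
      ((hyperfilter ℕ).map s) (by
        rw [le_principal_iff]
        exact Filter.mem_map.2 (Filter.univ_mem' hb))
    have hpt : Tendsto s (hyperfilter ℕ : Filter ℕ) (𝓝 p) := hp
    have hpL : p ∈ LU F := by
      intro ε hε
      filter_upwards [hpt (ball_mem_nhds p hε)] with n hn
      refine ⟨x n, hxf n, ?_⟩
      rw [mem_preimage, mem_ball, dist_eq_norm] at hn
      exact hn
    have h3 : c ≤ ℓ p := by
      refine ge_of_tendsto ((ℓ.continuous.tendsto p).comp hpt) ?_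
      filter_upwards [hyper_ge 1] with n hn
      have h1 : (0 : ℝ) < n := by exact_mod_cast hn
      simp only [Function.comp, hs, map_smul, smul_eq_mul]
      rw [le_inv_mul_iff₀ h1]
      exact (hx n hn).le
    exact absurd (h1 p hpL) (not_lt.2 h3)
  · intro v hv
    have : ∀ k : ℕ, ∃ n : ℕ, k ≤ n ∧ ∃ x : R2, ‖(n : ℝ)⁻¹ • ((⇑F)^[n] x - x) - v‖ < 1 / ((k : ℝ) + 1) := by
      intro k
      obtain ⟨n, h1, x, -, h2⟩ := ((hyper_ge k).and (hv (1 / ((k : ℝ) + 1)) (by positivity))).exists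
      exact ⟨n, h1, x, h2⟩
    choose n hn x hx using this
    refine ⟨x, n, tendsto_atTop_mono hn tendsto_id, ?_⟩
    rw [tendsto_iff_norm_sub_tendsto_zero]
    exact squeeze_zero (fun _ => norm_nonneg _) (fun k => (hx k).le) tendsto_one_div_add_atTop_nhds_zero_nat

lemma rotSet_convex {F : R2 ≃ₜ R2} (hF : Eqv F) : Convex ℝ (rotSet F) := by
  rw [rotSet_eq_LU hF]
  exact convex_of_mid (LU_closed F) (LU_mid hF)

lemma lattice_eq_range : (intLattice : Set R2) = range (fun p : ℤ × ℤ => (!₂[(p.1 : ℝ), (p.2 : ℝ)] : R2)) := by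
  ext v
  constructor
  · intro hv
    obtain ⟨m, hm⟩ := hv 0
    obtain ⟨n, hn⟩ := hv 1
    refine ⟨(m, n), ?_⟩
    ext i
    fin_cases i
    · simp [hm]
    · simp [hn]
  · rintro ⟨p, rfl⟩ i
    fin_cases i
    · exact ⟨p.1, by simp⟩
    · exact ⟨p.2, by simp⟩

lemma lattice_countable : (intLattice : Set R2).Countable := by
  rw [lattice_eq_range]; exact countable_range _

lemma lattice_closed : IsClosed (intLattice : Set R2) := by
  have : (intLattice : Set R2) = ⋂ i : Fin 2, (fun v : R2 => v i) ⁻¹' (range (Int.cast : ℤ → ℝ)) := by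
    ext v
    simp only [mem_iInter, mem_preimage, mem_range]
    constructor
    · intro hv i
      obtain ⟨n, hn⟩ := hv i
      exact ⟨n, hn.symm⟩
    · intro hv i
      obtain ⟨n, hn⟩ := hv i
      exact ⟨n, hn.symm⟩
  rw [this]
  refine isClosed_iInter fun i => ?_
  exact Int.isClosedEmbedding_coe_real.isClosed_range.preimage (by fun_prop)

/-- all lattice translates of `E` -/
def SE (E : Finset R2) : Set R2 := ⋃ e ∈ E, (fun x => x - e) ⁻¹' (intLattice : Set R2)

lemma mem_SE {E : Finset R2} {x : R2} : x ∈ SE E ↔ ∃ e ∈ E, x - e ∈ intLattice := by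
  simp [SE]

lemma SE_closed (E : Finset R2) : IsClosed (SE E) :=
  E.finite_toSet.isClosed_biUnion fun _ _ => lattice_closed.preimage (by fun_prop)

lemma SE_countable (E : Finset R2) : (SE E).Countable := by
  refine E.countable_toSet.biUnion fun e _ => ?_
  exact lattice_countable.preimage_of_injOn (sub_left_injective.injOn)

lemma SE_add {E : Finset R2} {x w : R2} (hw : w ∈ intLattice) (hx : x ∈ SE E) : x + w ∈ SE E := by
  rw [mem_SE] at *
  obtain ⟨e, he, h⟩ := hx
  exact ⟨e, he, by have := intLattice.add_mem h hw; convert this using 1; abel⟩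

lemma SE_sub {E : Finset R2} {x w : R2} (hw : w ∈ intLattice) (hx : x ∈ SE E) : x - w ∈ SE E := by
  rw [sub_eq_add_neg]; exact SE_add (intLattice.neg_mem hw) hx

/-- the push relation -/
def Push (U S : Set R2) (p q : R2) : Prop :=
  ∃ H : R2 ≃ₜ R2, Eqv H ∧ H p = q ∧ (∀ x ∈ S, H x = x) ∧
    ∀ x, H x = x ∨ ∃ k ∈ intLattice, x - k ∈ U ∧ H x - k ∈ U

lemma Push.symm' {U S : Set R2} {p q : R2} (h : Push U S p q) : Push U S q p := by
  obtain ⟨H, h1, h2, h3, h4⟩ := h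
  refine ⟨H.symm, h1.symm, by rw [← h2]; simp, fun x hx => ?_, fun x => ?_⟩
  · nth_rewrite 1 [← h3 x hx]; simp
  · rcases h4 (H.symm x) with h | ⟨k, hk, h5, h6⟩
    · left; rw [Homeomorph.apply_symm_apply] at h; exact h.symm
    · right; rw [Homeomorph.apply_symm_apply] at h6; exact ⟨k, hk, h6, h5⟩

lemma Push.trans' {U S : Set R2} (hU : ∀ x ∈ U, ∀ y ∈ U, dist x y < 1) {p q r : R2}
    (h : Push U S p q) (h' : Push U S q r) : Push U S p r := by
  obtain ⟨H, h1, h2, h3, h4⟩ := h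
  obtain ⟨K, k1, k2, k3, k4⟩ := h'
  refine ⟨H.trans K, h1.trans k1, by simp [h2, k2], fun x hx => by simp [h3 x hx, k3 x hx],
    fun x => ?_⟩
  simp only [Homeomorph.trans_apply]
  rcases h4 x with h | ⟨k, hk, h5, h6⟩
  · rw [h]; exact k4 x
  · rcases k4 (H x) with h | ⟨l, hl, h7, h8⟩
    · rw [h]; exact Or.inr ⟨k, hk, h5, h6⟩
    · have := hU _ h6 _ h7
      rw [dist_eq_norm] at this
      have e : H x - k - (H x - l) = l - k := by abel
      rw [e] at this
      have := lattice_norm_lt_one (intLattice.sub_mem hl hk) this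
      have : l = k := sub_eq_zero.1 this
      subst this
      exact Or.inr ⟨l, hk, h5, h8⟩

lemma homeo_of_small (g : R2 → R2) (c : ℝ) (hc0 : 0 ≤ c) (hc : c < 1)
    (h : ∀ x y, ‖g x - g y - (x - y)‖ ≤ c * ‖x - y‖) : ∃ H : R2 ≃ₜ R2, ∀ x, H x = g x := by
  have hA : ApproximatesLinearOn g ((ContinuousLinearEquiv.refl ℝ R2 : R2 ≃L[ℝ] R2) : R2 →L[ℝ] R2) univ c.toNNReal := by
    intro x _ y _
    have := h x y
    rwa [← Real.coe_toNNReal c hc0] at this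
  refine ⟨hA.toHomeomorph _ (Or.inr ?_), fun x => rfl⟩
  have : ‖((ContinuousLinearEquiv.refl ℝ R2).symm : R2 →L[ℝ] R2)‖₊ = 1 := by
    have : ((ContinuousLinearEquiv.refl ℝ R2).symm : R2 →L[ℝ] R2) = ContinuousLinearMap.id ℝ R2 := rfl
    rw [this]
    ext; simp
  rw [this]; simpa using hc

lemma push_local {U S : Set R2} (hS : ∀ x ∈ S, ∀ w ∈ intLattice, x - w ∈ S) {p q : R2} {s : ℝ} (hs : 0 < s)
    (hb : ball p (2 * s) ⊆ U \ S) (hq : q ∈ ball p s) : Push U S p q := by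
  set L : Set R2 := (fun k => p + k) '' (intLattice : Set R2) with hL
  have hLne : L.Nonempty := ⟨p + 0, 0, intLattice.zero_mem, rfl⟩
  set φ : R2 → ℝ := fun x => max 0 (1 - infDist x L / s) with hφ
  have hd : ‖q - p‖ < s := by rw [mem_ball, dist_eq_norm] at hq; exact hq
  have hφL : ∀ x y, |φ x - φ y| ≤ ‖x - y‖ / s := by
    intro x y
    have h1 : |φ x - φ y| ≤ |(1 - infDist x L / s) - (1 - infDist y L / s)| := by
      simp only [hφ]
      have := abs_max_sub_max_le_max (0 : ℝ) (1 - infDist x L / s) 0 (1 - infDist y L / s)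
      simpa using this
    refine h1.trans ?_
    have h2 := (lipschitz_infDist_pt L).dist_le_mul x y
    rw [Real.dist_eq, dist_eq_norm] at h2
    have : (1 - infDist x L / s) - (1 - infDist y L / s) = -((infDist x L - infDist y L) / s) := by ring
    rw [this, abs_neg, abs_div, abs_of_pos hs]
    gcongr
    simpa using h2
  have hφinv : ∀ x, ∀ w ∈ intLattice, φ (x + w) = φ x := by
    have key : ∀ x, ∀ w ∈ intLattice, infDist (x + w) L ≤ infDist x L := by
      intro x w hw
      refine le_of_forall_pos_lt_add fun ε hε => ?_
      obtain ⟨y, ⟨k, hk, rfl⟩, hy⟩ := (infDist_lt_iff hLne).1 (lt_add_of_pos_right (infDist x L) hε)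
      refine lt_of_le_of_lt (infDist_le_dist_of_mem (y := p + (k + w)) ⟨k + w, intLattice.add_mem hk hw, rfl⟩) ?_
      rw [← add_assoc, dist_add_right]; exact hy
    intro x w hw
    have h1 := key x w hw
    have h2 := key (x + w) (-w) (intLattice.neg_mem hw)
    rw [add_neg_cancel_right] at h2
    simp only [hφ, le_antisymm h1 h2]
  have hφ0 : ∀ x, 0 ≤ φ x := fun x => le_max_left _ _
  have hφ1 : ∀ x, φ x ≤ 1 := fun x => by
    apply max_le zero_le_one
    have : 0 ≤ infDist x L / s := div_nonneg infDist_nonneg hs.le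
    linarith
  have hφs : ∀ x, φ x ≠ 0 → ∃ k ∈ intLattice, dist (x - k) p < s := by
    intro x hx
    have : infDist x L < s := by
      by_contra hcon
      push Not at hcon
      apply hx
      apply max_eq_left
      have := (one_le_div hs).2 hcon
      linarith
    obtain ⟨y, ⟨k, hk, rfl⟩, hy⟩ := (infDist_lt_iff hLne).1 this
    refine ⟨k, hk, ?_⟩
    rw [dist_eq_norm] at hy ⊢
    have e : x - k - p = x - (p + k) := by abel
    rw [e]; exact hy
  obtain ⟨H, hH⟩ := homeo_of_small (fun x => x + φ x • (q - p)) (‖q - p‖ / s) (by positivity)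
    ((div_lt_one hs).2 hd) (by
      intro x y
      have e : x + φ x • (q - p) - (y + φ y • (q - p)) - (x - y) = (φ x - φ y) • (q - p) := by
        rw [sub_smul]; abel
      simp only [e, norm_smul, Real.norm_eq_abs]
      calc |φ x - φ y| * ‖q - p‖ ≤ ‖x - y‖ / s * ‖q - p‖ := by gcongr; exact hφL x y
        _ = ‖q - p‖ / s * ‖x - y‖ := by ring)
  refine ⟨H, fun x w hw => ?_, ?_, fun x hx => ?_, fun x => ?_⟩
  · rw [hH, hH, hφinv x w hw]; abel
  · have : infDist p L = 0 := by
      apply infDist_zero_of_mem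
      exact ⟨0, intLattice.zero_mem, by simp⟩
    rw [hH]; simp [hφ, this]
  · rw [hH]
    by_cases h : φ x = 0
    · simp [h]
    · obtain ⟨k, hk, h1⟩ := hφs x h
      exact absurd (hS x hx k hk) (hb (by rw [mem_ball]; linarith)).2
  · by_cases h : φ x = 0
    · left; rw [hH]; simp [h]
    · right
      obtain ⟨k, hk, h1⟩ := hφs x h
      refine ⟨k, hk, (hb (by rw [mem_ball]; linarith)).1, (hb ?_).1⟩
      rw [hH, mem_ball, dist_eq_norm]
      rw [dist_eq_norm] at h1
      have e : x + φ x • (q - p) - k - p = (x - k - p) + φ x • (q - p) := by abel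
      rw [e]
      refine (norm_add_le _ _).trans_lt ?_
      have : ‖φ x • (q - p)‖ ≤ ‖q - p‖ := by
        rw [norm_smul, Real.norm_eq_abs, abs_of_nonneg (hφ0 x)]
        exact mul_le_of_le_one_left (norm_nonneg _) (hφ1 x)
      linarith

lemma ball_diff_conn (c : R2) {r : ℝ} (hr : 0 < r) {S : Set R2} (hS : S.Countable) :
    IsPreconnected (ball c r \ S) := by
  set Φ := OpenPartialHomeomorph.univBall c r with hΦ
  have hsrc : Φ.source = univ := OpenPartialHomeomorph.univBall_source c r
  have htgt : Φ.target = ball c r := OpenPartialHomeomorph.univBall_target c hr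
  have hinj : Function.Injective Φ := by
    intro x y h
    exact Φ.injOn (by simp [hsrc]) (by simp [hsrc]) h
  have h1 : (Φ ⁻¹' S).Countable := hS.preimage_of_injOn hinj.injOn
  have hrk : 1 < Module.rank ℝ R2 := by
    rw [← Module.finrank_eq_rank]
    simp
  have h2 := (h1.isConnected_compl_of_one_lt_rank hrk).isPreconnected.image Φ
    (OpenPartialHomeomorph.continuous_univBall c r).continuousOn
  convert h2 using 1
  ext y
  constructor
  · rintro ⟨hy, hyS⟩
    have hy' : y ∈ Φ.target := by rw [htgt]; exact hy
    refine ⟨Φ.symm y, ?_, Φ.right_inv hy'⟩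
    simp only [mem_compl_iff, mem_preimage]
    rwa [Φ.right_inv hy']
  · rintro ⟨x, hx, rfl⟩
    refine ⟨?_, hx⟩
    rw [← htgt]
    exact Φ.map_source (by simp [hsrc])

lemma push_lemma {a b : R2} {r : ℝ} (hab : dist a b < r) (hr : r ≤ 1) (E : Finset R2)
    (ha : a ∉ SE E) (hb : b ∉ SE E) :
    ∃ H : R2 ≃ₜ R2, Eqv H ∧ H a = b ∧ (∀ e ∈ E, H e = e) ∧ ∀ x, dist (H x) x ≤ r := by
  have hr0 : 0 < r := dist_nonneg.trans_lt hab
  set c := midpoint ℝ a b with hc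
  set U := ball c (r / 2) with hU
  have hUd : ∀ x ∈ U, ∀ y ∈ U, dist x y < r := by
    intro x hx y hy
    rw [hU, mem_ball] at hx hy
    have := dist_triangle_right x y c
    linarith
  have hUd1 : ∀ x ∈ U, ∀ y ∈ U, dist x y < 1 := fun x hx y hy => (hUd x hx y hy).trans_le hr
  have haU : a ∈ U := by
    rw [hU, mem_ball, hc, dist_left_midpoint]; norm_num; linarith
  have hbU : b ∈ U := by
    rw [hU, mem_ball, hc, dist_right_midpoint]; norm_num; linarith
  have hopen : IsOpen (U \ SE E) := isOpen_ball.sdiff (SE_closed E)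
  have hP : Push U (SE E) a b := by
    refine (ball_diff_conn c (by linarith : 0 < r / 2) (SE_countable E)).induction₂ (Push U (SE E)) ?_ ?_ ?_
      ⟨haU, ha⟩ ⟨hbU, hb⟩
    · intro p hp
      obtain ⟨s, hs, hsb⟩ := Metric.isOpen_iff.1 hopen p hp
      refine mem_nhdsWithin_of_mem_nhds ?_
      filter_upwards [ball_mem_nhds p (half_pos hs)] with q hq
      exact push_local (fun x hx w hw => SE_sub hw hx) (half_pos hs) (by convert hsb using 2; ring) hq
    · intro x y z _ _ _ h1 h2
      exact h1.trans' hUd1 h2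
    · intro x y _ _ h
      exact h.symm'
  obtain ⟨H, h1, h2, h3, h4⟩ := hP
  refine ⟨H, h1, h2, fun e he => h3 e (mem_SE.2 ⟨e, he, by simp [intLattice.zero_mem]⟩), fun x => ?_⟩
  rcases h4 x with h | ⟨k, hk, h5, h6⟩
  · rw [h, dist_self]; exact hr0.le
  · have := hUd _ h6 _ h5
    rw [dist_sub_right] at this
    exact this.le

lemma exact_iter {G : R2 ≃ₜ R2} (hG : Eqv G) {n : ℕ} {x w : R2} (hw : w ∈ intLattice)
    (h : (⇑G)^[n] x = x + w) (k : ℕ) : (⇑G)^[n * k] x = x + (k : ℝ) • w := by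
  induction k with
  | zero => simp
  | succ k ih =>
    have hk : (k : ℝ) • w ∈ intLattice := by
      have := intLattice.nsmul_mem hw k
      rwa [← Nat.cast_smul_eq_nsmul ℝ] at this
    rw [Nat.mul_succ, add_comm, Function.iterate_add_apply, ih, hG.iter _ _ _ hk, h]
    push_cast
    rw [add_smul, one_smul]; abel

lemma exact_loop {G : R2 ≃ₜ R2} (hG : Eqv G) {n : ℕ} (hn : 1 ≤ n) {x w : R2} (hw : w ∈ intLattice)
    (h : (⇑G)^[n] x = x + w) : (n : ℝ)⁻¹ • w ∈ rotSet G := by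
  refine ⟨fun _ => x, fun k => n * (k + 1), ?_, ?_⟩
  · refine tendsto_atTop_mono (fun k => ?_) tendsto_id
    simp only [id]; nlinarith
  · refine tendsto_const_nhds.congr fun k => ?_
    have hn' : (n : ℝ) ≠ 0 := by positivity
    have hk' : ((k : ℝ) + 1) ≠ 0 := by positivity
    rw [exact_iter hG hw h]
    push_cast
    rw [add_sub_cancel_left, smul_smul]
    congr 1
    field_simp

/-- degenerate orbit segment -/
def Degen (G : R2 ≃ₜ R2) (n : ℕ) (x : R2) : Prop :=
  ∃ i j : ℕ, ∃ u ∈ intLattice, i < j ∧ j ≤ n ∧ j - i < n ∧ (⇑G)^[j] x = (⇑G)^[i] x + u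

lemma outer_eq {G : R2 ≃ₜ R2} (hG : Eqv G) {n i j : ℕ} {x u : R2} (hij : i < j) (hjn : j ≤ n)
    (hu : u ∈ intLattice) (h : (⇑G)^[j] x = (⇑G)^[i] x + u) :
    (⇑G)^[n - (j - i)] x = (⇑G)^[n] x - u := by
  have e1 : n - (j - i) = (n - j) + i := by omega
  have e2 : n = (n - j) + j := by omega
  rw [e1, Function.iterate_add_apply]
  conv_rhs => rw [e2, Function.iterate_add_apply, h, hG.iter _ _ _ hu]
  abel

lemma inner_eq {G : R2 ≃ₜ R2} {i j : ℕ} (hij : i < j) (x : R2) :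
    (⇑G)^[j - i] ((⇑G)^[i] x) = (⇑G)^[j] x := by
  rw [← Function.iterate_add_apply]; congr 2; omega

lemma push_loop {G : R2 ≃ₜ R2} (hG : Eqv G) {n : ℕ} (hn : 1 ≤ n) {x w : R2} (hw : w ∈ intLattice)
    (hnd : ¬ Degen G n x) {r : ℝ} (hr : r ≤ 1) (hd : dist ((⇑G)^[n] x) (x + w) < r) :
    ∃ G' : R2 ≃ₜ R2, Eqv G' ∧ (∀ y, dist (G y) (G' y) ≤ r) ∧ (⇑G')^[n] x = x + w := by
  classical
  obtain ⟨H, h1, h2, h3, h4⟩ := push_lemma hd hr ((Finset.Ioo 0 n).image (fun i => (⇑G)^[i] x))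
    (by
      intro hmem
      obtain ⟨e, he, hl⟩ := mem_SE.1 hmem
      obtain ⟨i, hi, rfl⟩ := Finset.mem_image.1 he
      rw [Finset.mem_Ioo] at hi
      exact hnd ⟨i, n, _, hl, hi.2, le_rfl, by omega, by abel⟩)
    (by
      intro hmem
      obtain ⟨e, he, hl⟩ := mem_SE.1 hmem
      obtain ⟨i, hi, rfl⟩ := Finset.mem_image.1 he
      rw [Finset.mem_Ioo] at hi
      refine hnd ⟨0, i, _, intLattice.sub_mem hw hl, hi.1, hi.2.le, by omega, ?_⟩
      simp only [Function.iterate_zero, id]; abel)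
  refine ⟨G.trans H, hG.trans h1, fun y => ?_, ?_⟩
  · rw [dist_comm]; exact h4 (G y)
  · have key : ∀ i < n, (⇑(G.trans H))^[i] x = (⇑G)^[i] x := by
      intro i
      induction i with
      | zero => intro _; rfl
      | succ i ih =>
        intro hi
        rw [Function.iterate_succ_apply', ih (by omega), Homeomorph.trans_apply,
          ← Function.iterate_succ_apply' (⇑G)]
        exact h3 _ (Finset.mem_image.2 ⟨i + 1, Finset.mem_Ioo.2 ⟨by omega, hi⟩, rfl⟩)
    obtain ⟨m, rfl⟩ : ∃ m, n = m + 1 := ⟨n - 1, by omega⟩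
    rw [Function.iterate_succ_apply', key m (by omega), Homeomorph.trans_apply,
      ← Function.iterate_succ_apply' (⇑G), h2]

lemma loop_lemma {F G : R2 ≃ₜ R2} (hF : Eqv F) (hG : Eqv G) {δ ε : ℝ} (hδ : δ ≤ 1) (hε : 0 ≤ ε)
    (hs : Stab F δ) (hFG : ∀ x, dist (F x) (G x) ≤ ε) :
    ∀ n : ℕ, 1 ≤ n → ∀ x w : R2, w ∈ intLattice → dist ((⇑G)^[n] x) (x + w) + ε < δ →
      (n : ℝ)⁻¹ • w ∈ rotSet F := by
  intro n
  induction n using Nat.strong_induction_on with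
  | _ n ih =>
  intro hn x w hw hd
  by_cases hdeg : Degen G n x
  · obtain ⟨i, j, u, hu, hij, hjn, hlt, h⟩ := hdeg
    have hin := inner_eq (G := G) hij x
    have hout := outer_eq hG hij hjn hu h
    set m := j - i with hm
    have hm1 : 1 ≤ m := by omega
    have h1 := ih m hlt hm1 ((⇑G)^[i] x) u hu (by
      rw [hin, h, dist_self]
      linarith [dist_nonneg (x := (⇑G)^[n] x) (y := x + w)])
    have h2 := ih (n - m) (by omega) (by omega) x (w - u) (intLattice.sub_mem hw hu) (by
      rw [hout, ← add_sub_assoc, dist_sub_right]; exact hd)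
    have hm0 : (0 : ℝ) < m := by exact_mod_cast hm1
    have hn0 : (0 : ℝ) < n := by exact_mod_cast hn
    have hnm : (m : ℝ) < n := by exact_mod_cast hlt
    rw [Nat.cast_sub hlt.le] at h2
    have hnm' : (n : ℝ) - m ≠ 0 := by linarith
    have := rotSet_convex hF h1 h2 (a := m / n) (b := (n - m) / n) (by positivity)
      (div_nonneg (by linarith) hn0.le) (by field_simp; ring)
    convert this using 1
    rw [smul_smul, smul_smul]
    have e1 : (m / n : ℝ) * (m : ℝ)⁻¹ = (n : ℝ)⁻¹ := by field_simp
    have e2 : ((n - m) / n : ℝ) * (n - m : ℝ)⁻¹ = (n : ℝ)⁻¹ := by field_simp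
    rw [e1, e2, ← smul_add]; congr 1; abel
  · obtain ⟨r, hr1, hr2⟩ := exists_between (show dist ((⇑G)^[n] x) (x + w) < δ - ε by linarith)
    obtain ⟨G', hG', hd', he⟩ := push_loop hG hn hw hdeg (by linarith) hr1
    refine hs G' hG' (ε + r) (fun y => ?_) (by linarith) (exact_loop hG' hn hw he)
    exact (dist_triangle _ (G y) _).trans (add_le_add (hFG y) (hd' y))

lemma exists_coloring {δ : ℝ} (hδ : 0 < δ) : ∃ (t : Finset R2) (κ : R2 → R2), (∀ x, κ x ∈ t) ∧
    ∀ x y, κ x = κ y → ∃ w ∈ intLattice, dist x (y + w) < δ := by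
  obtain ⟨s, hsf, hs⟩ := Metric.totallyBounded_iff.1 (isCompact_closedBall (0 : R2) 2).totallyBounded
    (δ / 2) (half_pos hδ)
  have hx : ∀ x : R2, ∃ y ∈ s, x - ipart x ∈ ball y (δ / 2) := by
    intro x
    have h0 : (0 : R2) ∈ fundDomain := by intro i; simp
    have := hs (a := x - ipart x) (by
      rw [mem_closedBall, dist_eq_norm]; exact fund_norm_le (fpart_mem x) h0)
    simpa using this
  choose κ h1 h2 using hx
  refine ⟨hsf.toFinset, κ, fun x => by simpa using h1 x, fun x y hxy => ?_⟩
  refine ⟨ipart x - ipart y, intLattice.sub_mem (ipart_mem x) (ipart_mem y), ?_⟩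
  have hx := h2 x
  have hy := h2 y
  rw [← hxy] at hy
  rw [mem_ball] at hx hy
  have := dist_triangle_right (x - ipart x) (y - ipart y) (κ x)
  have e : dist x (y + (ipart x - ipart y)) = dist (x - ipart x) (y - ipart y) := by
    rw [dist_eq_norm, dist_eq_norm]; congr 1; abel
  linarith

lemma ell_le {F : R2 ≃ₜ R2} {ℓ : R2 →L[ℝ] ℝ} {a : ℝ} (ha : ∀ v ∈ rotSet F, ℓ v ≤ a)
    {n : ℕ} (hn : 1 ≤ n) {w : R2} (h : (n : ℝ)⁻¹ • w ∈ rotSet F) : ℓ w ≤ n * a := by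
  have := ha _ h
  have hn0 : (0 : ℝ) < n := by exact_mod_cast hn
  rw [map_smul, smul_eq_mul, inv_mul_le_iff₀ hn0] at this
  exact this

lemma ell_norm (ℓ : R2 →L[ℝ] ℝ) (x : R2) : |ℓ x| ≤ ‖ℓ‖ * ‖x‖ := ℓ.le_opNorm x

lemma bdd_dev {F : R2 ≃ₜ R2} (hF : Eqv F) {δ : ℝ} (hδ0 : 0 < δ) (hδ : δ ≤ 1) (hs : Stab F δ)
    (ℓ : R2 →L[ℝ] ℝ) {a : ℝ} (ha : ∀ v ∈ rotSet F, ℓ v ≤ a) :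
    ∃ C : ℝ, 0 ≤ C ∧ ∀ n x, ℓ ((⇑F)^[n] x - x) ≤ n * a + C := by
  classical
  obtain ⟨t, κ, ht, hκ⟩ := exists_coloring hδ0
  obtain ⟨B, hB0, hB⟩ := hF.bdd
  set C₁ : ℝ := ‖ℓ‖ * δ + (‖ℓ‖ * B + |a|) with hC₁
  have hC₁0 : 0 ≤ C₁ := by positivity
  have key : ∀ (c : ℕ) (T : Finset R2), T.card = c → ∀ n x, (∀ i < n, κ ((⇑F)^[i] x) ∈ T) →
      ℓ ((⇑F)^[n] x - x) ≤ n * a + c * C₁ := by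
    intro c
    induction c with
    | zero =>
      intro T hT n x h
      rw [Finset.card_eq_zero] at hT
      subst hT
      rcases Nat.eq_zero_or_pos n with rfl | hn
      · simp
      · exact absurd (h 0 hn) (by simp)
    | succ c ih =>
      intro T hT n x h
      rcases Nat.eq_zero_or_pos n with rfl | hn
      · simp; positivity
      set Q := (Finset.range n).filter (fun i => κ ((⇑F)^[i] x) = κ x) with hQ
      have hQne : Q.Nonempty := ⟨0, by simp [hQ, hn]⟩
      obtain ⟨m, hmQ, hmax⟩ : ∃ m ∈ Q, ∀ i ∈ Q, i ≤ m := ⟨Q.max' hQne, Q.max'_mem _, fun i hi => Q.le_max' i hi⟩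
      rw [hQ, Finset.mem_filter, Finset.mem_range] at hmQ
      have hxT : κ x ∈ T := h 0 hn
      have h1 := ih (T.erase (κ x)) (by rw [Finset.card_erase_of_mem hxT, hT]; rfl) (n - (m + 1))
        ((⇑F)^[m + 1] x) (by
          intro i hi
          rw [← Function.iterate_add_apply, Finset.mem_erase]
          refine ⟨fun hc => ?_, h _ (by omega)⟩
          have := hmax (i + (m + 1)) (by rw [hQ, Finset.mem_filter, Finset.mem_range]; exact ⟨by omega, hc⟩)
          omega)
      rw [← Function.iterate_add_apply, Nat.sub_add_cancel (by omega), Nat.cast_sub (by omega)] at h1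
      have h2 : ℓ ((⇑F)^[m + 1] x - (⇑F)^[m] x) ≤ ‖ℓ‖ * B := by
        rw [Function.iterate_succ_apply']
        refine (le_abs_self _).trans ((ell_norm _ _).trans ?_)
        gcongr; exact hB _
      have h3 : ℓ ((⇑F)^[m] x - x) ≤ m * a + ‖ℓ‖ * δ := by
        rcases Nat.eq_zero_or_pos m with rfl | hm
        · simp; positivity
        obtain ⟨w, hw, hd⟩ := hκ _ _ hmQ.2
        have h4 := ell_le ha hm (loop_lemma hF hF hδ le_rfl hs (fun x => (dist_self _).le) m hm x w hw (by linarith))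
        have e : (⇑F)^[m] x - x = ((⇑F)^[m] x - (x + w)) + w := by abel
        rw [e, map_add]
        have h5 : ℓ ((⇑F)^[m] x - (x + w)) ≤ ‖ℓ‖ * δ := by
          refine (le_abs_self _).trans ((ell_norm _ _).trans ?_)
          rw [dist_eq_norm] at hd
          gcongr
        linarith
      have e : (⇑F)^[n] x - x = ((⇑F)^[n] x - (⇑F)^[m + 1] x) + ((⇑F)^[m + 1] x - (⇑F)^[m] x)
          + ((⇑F)^[m] x - x) := by abel
      rw [e, map_add, map_add]
      push_cast at h1 ⊢
      have := neg_abs_le a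
      nlinarith
  exact ⟨t.card * C₁, by positivity, fun n x => key _ t rfl n x fun i _ => ht _⟩

lemma near_loop {F : R2 ≃ₜ R2} (hF : Eqv F) {δ : ℝ} (hδ0 : 0 < δ) (hδ : δ ≤ 1) (hs : Stab F δ)
    (ℓ : R2 →L[ℝ] ℝ) {a : ℝ} (ha : IsLUB (ℓ '' rotSet F) a) {η σ : ℝ} (hη : 0 < η) (hσ : 0 < σ) :
    ∃ n : ℕ, 1 ≤ n ∧ ∃ x w : R2, w ∈ intLattice ∧ dist ((⇑F)^[n] x) (x + w) < η ∧ n * a - σ ≤ ℓ w := by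
  classical
  have ha' : ∀ v ∈ rotSet F, ℓ v ≤ a := fun v hv => ha.1 ⟨v, hv, rfl⟩
  obtain ⟨C, hC0, hC⟩ := bdd_dev hF hδ0 hδ hs ℓ ha'
  set η₁ := min η (σ / (2 * (‖ℓ‖ + 1))) with hη₁
  have hη₁0 : 0 < η₁ := lt_min hη (by positivity)
  have hη₁' : ‖ℓ‖ * η₁ ≤ σ / 2 := by
    have h1 : η₁ ≤ σ / (2 * (‖ℓ‖ + 1)) := min_le_right _ _
    calc ‖ℓ‖ * η₁ ≤ (‖ℓ‖ + 1) * (σ / (2 * (‖ℓ‖ + 1))) := by gcongr; linarith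
      _ = σ / 2 := by field_simp
  obtain ⟨t, κ, ht, hκ⟩ := exists_coloring hη₁0
  set I := Finset.Icc ⌊(-1 - C) / (σ / 2)⌋ ⌊C / (σ / 2)⌋ with hI
  set n := (t ×ˢ I).card + 1 with hn
  obtain ⟨x, hx⟩ : ∃ x, n * a - 1 ≤ ℓ ((⇑F)^[n] x - x) := by
    by_contra hcon
    push Not at hcon
    have hn0 : (0 : ℝ) < n := by positivity
    have : a ≤ a - 1 / n := by
      apply ha.2
      rintro _ ⟨v, hv, rfl⟩
      refine rot_le hF ℓ (n := n) (by omega) (fun y => ?_) hv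
      have e : (n : ℝ) * (a - 1 / n) = n * a - 1 := by field_simp
      rw [e]; exact (hcon y).le
    have : 0 < 1 / (n : ℝ) := by positivity
    linarith
  set D : ℕ → ℝ := fun k => ℓ ((⇑F)^[k] x - x) - k * a with hD
  have hD1 : ∀ k ≤ n, D k ≤ C := fun k _ => by
    have := hC k x
    simp only [hD]; linarith
  have hD2 : ∀ k ≤ n, -1 - C ≤ D k := fun k hk => by
    have h1 := hC (n - k) ((⇑F)^[k] x)
    rw [← Function.iterate_add_apply, Nat.sub_add_cancel hk, Nat.cast_sub hk] at h1
    have e : (⇑F)^[n] x - x = ((⇑F)^[n] x - (⇑F)^[k] x) + ((⇑F)^[k] x - x) := by abel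
    rw [e, map_add] at hx
    simp only [hD]; linarith
  have hσ2 : 0 < σ / 2 := half_pos hσ
  obtain ⟨s, hs', s', hs'', hne, heq⟩ := Finset.exists_ne_map_eq_of_card_lt_of_maps_to
    (s := Finset.range (n + 1)) (t := t ×ˢ I) (f := fun k => (κ ((⇑F)^[k] x), ⌊D k / (σ / 2)⌋))
    (by rw [Finset.card_range]; omega) (by
      intro k hk
      have hk' : k ≤ n := by
        have := Finset.mem_range.1 (Finset.mem_coe.1 hk); omega
      rw [Finset.mem_coe, Finset.mem_product]
      refine ⟨ht _, Finset.mem_Icc.2 ⟨Int.floor_le_floor ?_, Int.floor_le_floor ?_⟩⟩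
      · have := hD2 k hk'; gcongr
      · have := hD1 k hk'; gcongr)
  have main : ∀ s s' : ℕ, s < s' → s' ≤ n → κ ((⇑F)^[s'] x) = κ ((⇑F)^[s] x) →
      ⌊D s / (σ / 2)⌋ = ⌊D s' / (σ / 2)⌋ → ∃ n : ℕ, 1 ≤ n ∧ ∃ x w : R2, w ∈ intLattice ∧
        dist ((⇑F)^[n] x) (x + w) < η ∧ n * a - σ ≤ ℓ w := by
    intro s s' hss hsn h1 h2
    obtain ⟨w, hw, hd⟩ := hκ _ _ h1
    refine ⟨s' - s, by omega, (⇑F)^[s] x, w, hw, ?_, ?_⟩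
    · rw [inner_eq hss]; exact hd.trans_le (min_le_left _ _)
    · have h3 := Int.abs_sub_lt_one_of_floor_eq_floor h2
      rw [← sub_div, abs_div, abs_of_pos hσ2, div_lt_one hσ2] at h3
      have h4 := (abs_lt.1 h3).2
      have e : w = ((⇑F)^[s'] x - x) - ((⇑F)^[s] x - x) - ((⇑F)^[s'] x - ((⇑F)^[s] x + w)) := by abel
      have h5 : ℓ ((⇑F)^[s'] x - ((⇑F)^[s] x + w)) ≤ ‖ℓ‖ * η₁ := by
        refine (le_abs_self _).trans ((ell_norm _ _).trans ?_)
        rw [dist_eq_norm] at hd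
        gcongr
      have h6 : ℓ w = ℓ ((⇑F)^[s'] x - x) - ℓ ((⇑F)^[s] x - x) - ℓ ((⇑F)^[s'] x - ((⇑F)^[s] x + w)) := by
        rw [← map_sub, ← map_sub, ← e]
      rw [Nat.cast_sub hss.le, h6]
      simp only [hD] at h4
      linarith
  rw [Finset.mem_range] at hs' hs''
  simp only [Prod.mk.injEq] at heq
  rcases lt_or_gt_of_ne hne with h | h
  · exact main s s' h (by omega) heq.1.symm heq.2
  · exact main s' s h (by omega) heq.1 heq.2.symm

lemma exact_near {F : R2 ≃ₜ R2} (hF : Eqv F) {δ : ℝ} (hδ0 : 0 < δ) (hδ : δ ≤ 1) (hs : Stab F δ)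
    (ℓ : R2 →L[ℝ] ℝ) {a : ℝ} (ha : IsLUB (ℓ '' rotSet F) a) {η σ : ℝ} (hη : 0 < η) (hηδ : η < δ)
    (hσ : 0 < σ) :
    ∃ G : R2 ≃ₜ R2, Eqv G ∧ (∀ y, dist (F y) (G y) ≤ η) ∧ ∃ n : ℕ, 1 ≤ n ∧ ∃ x w : R2,
      w ∈ intLattice ∧ (⇑G)^[n] x = x + w ∧ n * a - σ ≤ ℓ w := by
  have ha' : ∀ v ∈ rotSet F, ℓ v ≤ a := fun v hv => ha.1 ⟨v, hv, rfl⟩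
  obtain ⟨n, hn, x, w, hw, hd, hl⟩ := near_loop hF hδ0 hδ hs ℓ ha hη hσ
  induction n using Nat.strong_induction_on generalizing x w with
  | _ n ih =>
  by_cases hdeg : Degen F n x
  · obtain ⟨i, j, u, hu, hij, hjn, hlt, h⟩ := hdeg
    have hout := outer_eq hF hij hjn hu h
    have hin := inner_eq (G := F) hij x
    have h2 := ell_le ha' (by omega : 1 ≤ n - (j - i)) (loop_lemma hF hF hδ le_rfl hs (fun x => (dist_self _).le) _
      (by omega : 1 ≤ n - (j - i)) x (w - u) (intLattice.sub_mem hw hu) (by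
        rw [hout, ← add_sub_assoc, dist_sub_right]; linarith))
    rw [map_sub, Nat.cast_sub hlt.le] at h2
    refine ih (j - i) hlt (by omega) ((⇑F)^[i] x) u hu (by rw [hin, h, dist_self]; exact hη) (by linarith)
  · obtain ⟨G, hG, h1, h2⟩ := push_loop hF hn hw hdeg (by linarith : η ≤ 1) hd
    exact ⟨G, hG, h1, n, hn, x, w, hw, h2, hl⟩

lemma fund_eq : fundDomain = (WithLp.ofLp : R2 → (Fin 2 → ℝ)) ⁻¹' (Set.univ.pi fun _ => Set.Ico (0 : ℝ) 1) := by
  ext x; simp only [fundDomain, mem_preimage, Set.mem_pi, mem_univ, true_imp_iff]; rfl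

lemma fund_meas : MeasurableSet fundDomain := by
  rw [fund_eq]
  exact (MeasurableSet.univ_pi fun _ => measurableSet_Ico).preimage (PiLp.volume_preserving_ofLp (Fin 2)).measurable

lemma fund_vol : volume fundDomain = 1 := by
  rw [fund_eq, (PiLp.volume_preserving_ofLp (Fin 2)).measure_preimage
    (MeasurableSet.univ_pi fun _ => measurableSet_Ico).nullMeasurableSet, Real.volume_pi_Ico]
  simp

lemma fund_dom : IsAddFundamentalDomain intLattice fundDomain (volume : Measure R2) := by
  refine ⟨fund_meas.nullMeasurableSet, Eventually.of_forall fun x => ?_, ?_⟩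
  · refine ⟨⟨-ipart x, intLattice.neg_mem (ipart_mem x)⟩, ?_⟩
    have := fpart_mem x
    rw [sub_eq_neg_add] at this
    exact this
  · intro g h hgh
    apply Disjoint.aedisjoint
    rw [Set.disjoint_left]
    rintro _ ⟨x, hx, rfl⟩ ⟨y, hy, hxy⟩
    apply hgh
    have hxy' : (h : R2) + y = g + x := hxy
    apply Subtype.ext
    ext i
    obtain ⟨m, hm⟩ := g.2 i
    obtain ⟨n, hn⟩ := h.2 i
    have e : (h : R2) i + y i = (g : R2) i + x i := by
      have := congrArg (fun v : R2 => v i) hxy'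
      simpa using this
    have h1 := hx i
    have h2 := hy i
    rw [hm, hn] at e
    have e1 : (m : ℝ) < n + 1 := by linarith [h1.1, h1.2, h2.1, h2.2]
    have e2 : (n : ℝ) < m + 1 := by linarith [h1.1, h1.2, h2.1, h2.2]
    have e3 : m < n + 1 := by exact_mod_cast e1
    have e4 : n < m + 1 := by exact_mod_cast e2
    have : m = n := by omega
    rw [hm, hn, this]

lemma packing {d : ℝ} (hd0 : 0 < d) (hd : d ≤ 1) (p : ℕ → R2) (N : ℕ)
    (hN : 1 < (N + 1) * (Real.pi * (d / 2) ^ 2)) :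
    ∃ i j : ℕ, ∃ u ∈ intLattice, i < j ∧ j ≤ N ∧ dist (p j) (p i + u) < d := by
  have key : ∀ i ≤ N, ∀ j ≤ N, i ≠ j → ∀ u ∈ intLattice, dist (p i) (p j + u) < d →
      ∃ i j : ℕ, ∃ u ∈ intLattice, i < j ∧ j ≤ N ∧ dist (p j) (p i + u) < d := by
    intro i hi j hj hij u hu h
    rcases lt_or_gt_of_ne hij with h1 | h1
    · refine ⟨i, j, -u, intLattice.neg_mem hu, h1, hj, ?_⟩
      rw [dist_comm, dist_eq_norm] at h
      rw [dist_eq_norm]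
      have e : p j - (p i + -u) = p j + u - p i := by abel
      rw [e]; exact h
    · exact ⟨j, i, u, hu, h1, hi, h⟩
  by_cases hdis : ∀ i ∈ Finset.range (N + 1), ∀ j ∈ Finset.range (N + 1), i ≠ j →
      Disjoint (ball (p i) (d / 2)) (ball (p j) (d / 2))
  · set S := ⋃ i ∈ Finset.range (N + 1), ball (p i) (d / 2) with hS
    have hSm : MeasurableSet S := Finset.measurableSet_biUnion _ fun i _ => measurableSet_ball
    have hvol : volume S = (N + 1 : ℕ) * (ENNReal.ofReal (d / 2) ^ 2 * ENNReal.ofReal Real.pi) := by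
      rw [hS, measure_biUnion_finset (fun i hi j hj hij => hdis i hi j hj hij) (fun i _ => measurableSet_ball)]
      simp only [EuclideanSpace.volume_ball_fin_two, Finset.sum_const, Finset.card_range, nsmul_eq_mul]
    have hlt : volume fundDomain < volume S := by
      rw [fund_vol, hvol, ← ENNReal.ofReal_pow (by positivity), ← ENNReal.ofReal_mul (by positivity),
        ← ENNReal.ofReal_natCast, ← ENNReal.ofReal_mul (by positivity), ENNReal.one_lt_ofReal]
      push_cast
      linarith
    have : Countable intLattice := lattice_countable.to_subtype
    obtain ⟨g, h, hgh, hnd⟩ := exists_pair_mem_lattice_not_disjoint_vadd fund_dom hSm.nullMeasurableSet hlt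
    obtain ⟨z, ⟨x, hx, hxz⟩, ⟨y, hy, hyz⟩⟩ := Set.not_disjoint_iff.1 hnd
    have hxz' : (g : R2) + x = z := hxz
    have hyz' : (h : R2) + y = z := hyz
    rw [hS, mem_iUnion₂] at hx hy
    obtain ⟨i, hi, hxi⟩ := hx
    obtain ⟨j, hj, hyj⟩ := hy
    rw [Finset.mem_range] at hi hj
    rw [mem_ball, dist_eq_norm] at hxi hyj
    have hfin : dist (p i) (p j + ((h : R2) - g)) < d := by
      rw [dist_eq_norm]
      have e : p i - (p j + ((h : R2) - g)) = (y - p j) - (x - p i) := by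
        have h3 : y - x = (g : R2) - h := by
          rw [sub_eq_sub_iff_add_eq_add, add_comm y, hyz', ← hxz']
        have h4 : p i - (p j + ((h : R2) - g)) = ((g : R2) - h) + (p i - p j) := by abel
        rw [h4, ← h3]; abel
      rw [e]
      refine (norm_sub_le _ _).trans_lt (by linarith)
    by_cases hij : i = j
    · exfalso
      subst hij
      rw [dist_eq_norm, sub_add_cancel_left, norm_neg] at hfin
      have := lattice_norm_lt_one (intLattice.sub_mem h.2 g.2) (hfin.trans_le hd)
      exact hgh (Subtype.ext (sub_eq_zero.1 this).symm)
    · exact key i (by omega) j (by omega) hij _ (intLattice.sub_mem h.2 g.2) hfin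
  · push Not at hdis
    obtain ⟨i, hi, j, hj, hij, hnd⟩ := hdis
    rw [Finset.mem_range] at hi hj
    obtain ⟨z, h1, h2⟩ := Set.not_disjoint_iff.1 hnd
    rw [mem_ball] at h1 h2
    refine key i (by omega) j (by omega) hij 0 intLattice.zero_mem ?_
    rw [add_zero]
    have := dist_triangle_left (p i) (p j) z
    linarith

lemma good_vertex {F : R2 ≃ₜ R2} (hF : Eqv F) {δ : ℝ} (hδ : δ ≤ 1) (hs : Stab F δ)
    {d : ℝ} (hd0 : 0 < d) (hd : d < δ)
    (ℓ : R2 →L[ℝ] ℝ) {a : ℝ} (ha : IsLUB (ℓ '' rotSet F) a) {σ : ℝ} (hσ : 0 < σ) :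
    ∃ m : ℕ, 1 ≤ m ∧ ∃ u ∈ intLattice, (m : ℝ) * (Real.pi * (d / 2) ^ 2) ≤ 1 ∧
      (m : ℝ)⁻¹ • u ∈ rotSet F ∧ m * a - σ ≤ ℓ u := by
  have ha' : ∀ v ∈ rotSet F, ℓ v ≤ a := fun v hv => ha.1 ⟨v, hv, rfl⟩
  have hδ0 : 0 < δ := hd0.trans hd
  set η := (δ - d) / 2 with hη
  obtain ⟨G, hG, hFG, n, hn, x, w, hw, hx, hl⟩ := exact_near hF hδ0 hδ hs ℓ ha (η := η)
    (by linarith) (by linarith) hσ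
  set c := Real.pi * (d / 2) ^ 2 with hc
  have hc0 : 0 < c := by positivity
  by_cases hnc : (n : ℝ) * c ≤ 1
  · exact ⟨n, hn, w, hw, hnc, hs G hG η hFG (by linarith) (exact_loop hG hn hw hx), hl⟩
  · push Not at hnc
    set N := ⌊1 / c⌋₊ with hN
    have hN1 : (N : ℝ) * c ≤ 1 := by
      have := Nat.floor_le (show 0 ≤ 1 / c by positivity)
      rwa [le_div_iff₀ hc0] at this
    have hN2 : 1 < (N + 1 : ℝ) * c := by
      have := Nat.lt_floor_add_one (1 / c)
      rwa [div_lt_iff₀ hc0] at this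
    have hNn : N < n := by
      by_contra h
      push Not at h
      have : (n : ℝ) ≤ N := by exact_mod_cast h
      nlinarith
    obtain ⟨i, j, u, hu, hij, hjN, hdist⟩ := packing hd0 (by linarith) (fun k => (⇑G)^[k] x) N hN2
    have hin := loop_lemma hF hG hδ (by linarith : 0 ≤ η) hs hFG (j - i) (by omega) ((⇑G)^[i] x) u hu (by
      rw [inner_eq hij]; linarith)
    have e : (⇑G)^[n - (j - i)] ((⇑G)^[j] x) = (⇑G)^[i] x + w := by
      rw [← Function.iterate_add_apply, show n - (j - i) + j = i + n by omega,
        Function.iterate_add_apply, hx, hG.iter _ _ _ hw]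
    have hout := loop_lemma hF hG hδ (by linarith : 0 ≤ η) hs hFG (n - (j - i)) (by omega) ((⇑G)^[j] x)
      (w - u) (intLattice.sub_mem hw hu) (by
        have e2 : dist ((⇑G)^[i] x + w) ((⇑G)^[j] x + (w - u)) = dist ((⇑G)^[j] x) ((⇑G)^[i] x + u) := by
          rw [dist_comm, dist_eq_norm, dist_eq_norm]; congr 1; abel
        rw [e, e2]; linarith)
    have h2 := ell_le ha' (by omega) hout
    rw [map_sub, Nat.cast_sub (by omega)] at h2
    refine ⟨j - i, by omega, u, hu, ?_, hin, by linarith⟩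
    refine le_trans ?_ hN1
    have : ((j - i : ℕ) : ℝ) ≤ N := by exact_mod_cast (by omega)
    gcongr

/-- candidate vertices -/
def Cand (F : R2 ≃ₜ R2) (d : ℝ) : Set R2 :=
  {v | v ∈ rotSet F ∧ ∃ m : ℕ, 1 ≤ m ∧ (m : ℝ) * (Real.pi * (d / 2) ^ 2) ≤ 1 ∧
    ∃ u ∈ intLattice, v = (m : ℝ)⁻¹ • u}

lemma lattice_ball_finite (R : ℝ) : {u : R2 | u ∈ intLattice ∧ ‖u‖ ≤ R}.Finite := by
  refine (((Set.finite_Icc (-⌈R⌉) ⌈R⌉).prod (Set.finite_Icc (-⌈R⌉) ⌈R⌉)).image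
    (fun p : ℤ × ℤ => (!₂[(p.1 : ℝ), (p.2 : ℝ)] : R2))).subset ?_
  rintro u ⟨hu, hR⟩
  have hu' : u ∈ (intLattice : Set R2) := hu
  rw [lattice_eq_range] at hu'
  obtain ⟨⟨m, n⟩, rfl⟩ := hu'
  have key : ∀ k : ℤ, |(k : ℝ)| ≤ R → k ∈ Set.Icc (-⌈R⌉) ⌈R⌉ := by
    intro k hk
    have h1 := abs_le.1 (hk.trans (Int.le_ceil R))
    constructor
    · exact_mod_cast h1.1
    · exact_mod_cast h1.2
  refine ⟨(m, n), ⟨key m ?_, key n ?_⟩, rfl⟩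
  · have := (coord_le_norm _ 0).trans hR
    simpa using this
  · have := (coord_le_norm _ 1).trans hR
    simpa using this

lemma cand_finite {F : R2 ≃ₜ R2} (hF : Eqv F) {d : ℝ} (hd0 : 0 < d) : (Cand F d).Finite := by
  obtain ⟨C, hC0, hC⟩ := hF.bdd
  set c := Real.pi * (d / 2) ^ 2 with hc
  have hc0 : 0 < c := by positivity
  refine ((Finset.range (⌊1 / c⌋₊ + 1)).finite_toSet.biUnion (t := fun m : ℕ =>
    (fun u : R2 => (m : ℝ)⁻¹ • u) '' {u : R2 | u ∈ intLattice ∧ ‖u‖ ≤ m * C}) fun m _ =>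
      (lattice_ball_finite _).image _).subset ?_
  rintro v ⟨hv, m, hm, hmc, u, hu, rfl⟩
  have hm0 : (0 : ℝ) < m := by exact_mod_cast hm
  rw [mem_iUnion₂]
  refine ⟨m, ?_, u, ⟨hu, ?_⟩, rfl⟩
  · rw [Finset.mem_coe, Finset.mem_range, Nat.lt_succ_iff]
    apply Nat.le_floor
    rwa [le_div_iff₀ hc0]
  · have := rotSet_bdd hC hv
    rw [norm_smul, norm_inv, Real.norm_natCast, inv_mul_le_iff₀ hm0] at this
    exact this

lemma rotSet_eq_hull {F : R2 ≃ₜ R2} (hF : Eqv F) {δ : ℝ} (hs : Stab F δ)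
    {d : ℝ} (hd0 : 0 < d) (hd : d < δ) : rotSet F = convexHull ℝ (Cand F d) := by
  have hδ := stab_le_one hF hs
  apply Subset.antisymm
  · intro z hz
    by_contra hcon
    obtain ⟨ℓ, c, h1, h2⟩ := geometric_hahn_banach_closed_point (convex_convexHull ℝ (Cand F d))
      ((cand_finite hF hd0).isClosed_convexHull (𝕜 := ℝ)) hcon
    obtain ⟨C, hC0, hC⟩ := hF.bdd
    have hbdd : BddAbove (ℓ '' rotSet F) := by
      refine ⟨‖ℓ‖ * C, ?_⟩
      rintro _ ⟨v, hv, rfl⟩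
      refine (le_abs_self _).trans ((ell_norm ℓ v).trans ?_)
      gcongr
      exact rotSet_bdd hC hv
    have ha := isLUB_csSup ((rotSet_nonempty hF).image ℓ) hbdd
    set a := sSup (ℓ '' rotSet F) with ha_def
    have hca : c < a := h2.trans_le (ha.1 ⟨z, hz, rfl⟩)
    obtain ⟨m, hm, u, hu, hmc, hmem, hl⟩ := good_vertex hF hδ hs hd0 hd ℓ ha (sub_pos.2 hca)
    have h3 := h1 _ (subset_convexHull ℝ _ ⟨hmem, m, hm, hmc, u, hu, rfl⟩)
    have hm1 : (1 : ℝ) ≤ m := by exact_mod_cast hm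
    rw [map_smul, smul_eq_mul, inv_mul_lt_iff₀ (by linarith)] at h3
    nlinarith
  · exact convexHull_min (fun v hv => hv.1) (rotSet_convex hF)

lemma dvd_of_reduced {p₁ p₂ q m : ℤ} (h : Int.gcd p₁ (Int.gcd p₂ q) = 1) (h1 : q ∣ m * p₁)
    (h2 : q ∣ m * p₂) : q ∣ m := by
  have e1 := Int.gcd_eq_gcd_ab p₁ (Int.gcd p₂ q)
  have e2 := Int.gcd_eq_gcd_ab p₂ q
  rw [h] at e1
  have h3 : q ∣ m * (Int.gcd p₂ q : ℤ) := by
    rw [e2, mul_add, ← mul_assoc, ← mul_assoc]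
    exact dvd_add (h2.mul_right _) ((dvd_mul_left q m).mul_right _)
  have : m = m * p₁ * Int.gcdA p₁ (Int.gcd p₂ q) + m * (Int.gcd p₂ q : ℤ) * Int.gcdB p₁ (Int.gcd p₂ q) := by
    push_cast at e1
    linear_combination m * e1
  rw [this]
  exact dvd_add (h1.mul_right _) (h3.mul_right _)

lemma cand_bound {F : R2 ≃ₜ R2} {d : ℝ} (hd0 : 0 < d) {v : R2} (hv : v ∈ Cand F d) {p₁ p₂ q : ℤ}
    (hq : 1 ≤ q) (h : Int.gcd p₁ (Int.gcd p₂ q) = 1) (h0 : v 0 = (p₁ : ℝ) / q)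
    (h1 : v 1 = (p₂ : ℝ) / q) : (q : ℝ) ≤ 4 / (Real.pi * d ^ 2) := by
  obtain ⟨-, m, hm, hmc, u, hu, rfl⟩ := hv
  have hm0 : (0 : ℝ) < m := by exact_mod_cast hm
  have hq0 : (0 : ℝ) < q := by exact_mod_cast hq
  have key : ∀ (i : Fin 2) (p : ℤ), ((m : ℝ)⁻¹ • u) i = (p : ℝ) / q → q ∣ (m : ℤ) * p := by
    intro i p hp
    obtain ⟨k, hk⟩ := hu i
    rw [PiLp.smul_apply, hk, smul_eq_mul] at hp
    refine ⟨k, ?_⟩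
    have : (m : ℝ) * p = q * k := by field_simp at hp; linarith
    exact_mod_cast this
  have hdvd := dvd_of_reduced h (key 0 p₁ h0) (key 1 p₂ h1)
  have hle : q ≤ m := Int.le_of_dvd (by omega) hdvd
  have hle' : (q : ℝ) ≤ m := by exact_mod_cast hle
  rw [le_div_iff₀ (by positivity)]
  have : (q : ℝ) * (Real.pi * (d / 2) ^ 2) ≤ 1 := le_trans (by gcongr) hmc
  nlinarith

lemma cand_rational {F : R2 ≃ₜ R2} {d : ℝ} {v : R2} (hv : v ∈ Cand F d) : IsRationalPoint v := by
  obtain ⟨-, m, hm, hmc, u, hu, rfl⟩ := hv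
  intro i
  obtain ⟨k, hk⟩ := hu i
  refine ⟨(m : ℚ)⁻¹ * k, ?_⟩
  rw [PiLp.smul_apply, hk]
  push_cast
  rfl

lemma final_thm {F : R2 ≃ₜ R2} (hF : Eqv F) {δ : ℝ} (hδ : 0 < δ) (hs : Stab F δ) :
      (∀ v ∈ Set.extremePoints ℝ (rotSet F), IsRationalPoint v) ∧
      (∀ v ∈ Set.extremePoints ℝ (rotSet F), ∀ p₁ p₂ q : ℤ, 1 ≤ q →
        Int.gcd p₁ (Int.gcd p₂ q) = 1 →
        v 0 = (p₁ : ℝ) / (q : ℝ) → v 1 = (p₂ : ℝ) / (q : ℝ) →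
        (q : ℝ) ≤ 4 / (Real.pi * δ ^ 2)) ∧
      (Set.extremePoints ℝ (rotSet F)).Finite ∧
      (∃ V : Finset R2, (∀ v ∈ V, IsRationalPoint v) ∧
        rotSet F = convexHull ℝ (V : Set R2)) := by
  have hext : ∀ d, 0 < d → d < δ → Set.extremePoints ℝ (rotSet F) ⊆ Cand F d := by
    intro d h0 h1
    rw [rotSet_eq_hull hF hs h0 h1]
    exact extremePoints_convexHull_subset
  have hh := hext (δ / 2) (by linarith) (by linarith)
  have hfin := cand_finite hF (d := δ / 2) (by linarith)
  refine ⟨fun v hv => cand_rational (hh hv), ?_, hfin.subset hh, hfin.toFinset,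
    fun v hv => cand_rational (hfin.mem_toFinset.1 hv), ?_⟩
  · intro v hv p₁ p₂ q hq hg h0 h1
    have hb : ∀ d, 0 < d → d < δ → (q : ℝ) ≤ 4 / (Real.pi * d ^ 2) := fun d hd hd' =>
      cand_bound hd (hext d hd hd' hv) hq hg h0 h1
    have ht : Tendsto (fun d : ℝ => 4 / (Real.pi * d ^ 2)) (𝓝[<] δ) (𝓝 (4 / (Real.pi * δ ^ 2))) := by
      have : ContinuousAt (fun d : ℝ => 4 / (Real.pi * d ^ 2)) δ := by
        apply ContinuousAt.div continuousAt_const (by fun_prop)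
        positivity
      exact this.tendsto.mono_left nhdsWithin_le_nhds
    refine ge_of_tendsto ht ?_
    filter_upwards [Ioo_mem_nhdsLT hδ] with d hd
    exact hb d hd.1 hd.2
  · rw [hfin.coe_toFinset]
    exact rotSet_eq_hull hF hs (by linarith) (by linarith)

/-- If the rotation set of `f ∈ Homeo₀(T²)` is `δ`-upper-stable in
`Homeo₀(T²)` for some `δ > 0`, then for any lift `F` every extremal point of `ρ(F)` is
rational, its reduced denominator `q` satisfies `q ≤ 4/(πδ²)`, there are finitely many
extremal points, and `ρ(F)` is the convex hull of a finite subset of `ℚ²`. -/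
theorem upper_stable_extreme_points_bound (f : T2 ≃ₜ T2) (hf : f ∈ Homeo0)
    (δ : ℝ) (hδ : 0 < δ)
    (hstab : ∃ F₀ : R2 ≃ₜ R2, IsLift f F₀ ∧ UpperStable Homeo0 F₀ δ) :
    ∀ F : R2 ≃ₜ R2, IsLift f F →
      (∀ v ∈ Set.extremePoints ℝ (rotSet F), IsRationalPoint v) ∧
      (∀ v ∈ Set.extremePoints ℝ (rotSet F), ∀ p₁ p₂ q : ℤ, 1 ≤ q →
        Int.gcd p₁ (Int.gcd p₂ q) = 1 →
        v 0 = (p₁ : ℝ) / (q : ℝ) → v 1 = (p₂ : ℝ) / (q : ℝ) →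
        (q : ℝ) ≤ 4 / (Real.pi * δ ^ 2)) ∧
      (Set.extremePoints ℝ (rotSet F)).Finite ∧
      (∃ V : Finset R2, (∀ v ∈ V, IsRationalPoint v) ∧
        rotSet F = convexHull ℝ (V : Set R2)) := by
  intro F hF
  obtain ⟨F₀, h₀, hs⟩ := hstab
  exact final_thm hF.equivariant hδ (stab_of h₀ hs hF)
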